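/- Let P be a holomorphic map on a neighborhood of 0 in ℂ² of the form P(x,y) = (x + (π²/4)·y + x² + x³·a(x,y), y − y² + y³·b(x,y)), where a and b are holomorphic near 0, and suppose 0 is an isolated fixed point of P. Then P has a parabolic curve at 0 that is not contained in the invariant curve {y = 0}. -/

import Mathlib

open Filter Topology Metric

noncomputable section

/-- `Ω` is a parabolic curve of `F` at `0`: `Ω = φ(D)` with `D ⊆ ℂ` a simply connected
domain and `φ : D → ℂ²` injective holomorphic, `0 ∈ closure Ω \ Ω`, `Ω` positively invariant
by `F`, and the iterates of `F` tend to `0` uniformly on compact subsets of `Ω`. -/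
def IsParabolicCurve (F : ℂ × ℂ → ℂ × ℂ) (Ω : Set (ℂ × ℂ)) : Prop :=
  (∃ (D : Set ℂ) (φ : ℂ → ℂ × ℂ),
      IsOpen D ∧ IsConnected D ∧ SimplyConnectedSpace D ∧
      DifferentiableOn ℂ φ D ∧ Set.InjOn φ D ∧ Ω = φ '' D) ∧
  (0 : ℂ × ℂ) ∈ closure Ω ∧ (0 : ℂ × ℂ) ∉ Ω ∧
  F '' Ω ⊆ Ω ∧
  (∀ K ⊆ Ω, IsCompact K → TendstoUniformlyOn (fun n z => F^[n] z) 0 atTop K)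

def NN (w : ℂ) (d : ℂ × ℂ) : ℝ := ‖d.1‖ + ‖w‖ ^ 2 * ‖d.2‖

theorem NN_zero (w : ℂ) : NN w 0 = 0 := by simp [NN]

theorem NN_nonneg (w : ℂ) (d : ℂ × ℂ) : 0 ≤ NN w d := by unfold NN; positivity

theorem NN_sub_comm (w : ℂ) (d e : ℂ × ℂ) : NN w (d - e) = NN w (e - d) := by
  simp only [NN, Prod.fst_sub, Prod.snd_sub, norm_sub_rev]

theorem norm_le_NN {w : ℂ} (hw : 1 ≤ ‖w‖) (d : ℂ × ℂ) : ‖d‖ ≤ NN w d := by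
  unfold NN
  have h1 := norm_nonneg d.1
  have h2 := norm_nonneg d.2
  have h3 : (1:ℝ) ≤ ‖w‖ ^ 2 := one_le_pow₀ hw
  rw [Prod.norm_def]
  apply max_le <;> nlinarith

theorem NN_continuous (w : ℂ) : Continuous (NN w) := by unfold NN; fun_prop

def itr (G : ℂ → ℂ) (Q : ℂ × ℂ → ℂ × ℂ) (φ0 : ℂ → ℂ × ℂ) : ℕ → ℂ → ℂ × ℂ
  | 0 => φ0
  | (n + 1) => fun w => Q (itr G Q φ0 n (G w))

theorem growth_iter {W : Set ℂ} {G : ℂ → ℂ} (hG : Set.MapsTo G W W)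
    (hgr : ∀ w ∈ W, ‖w‖ ^ 2 + 1 / 2 ≤ ‖G w‖ ^ 2) (n : ℕ) :
    ∀ w ∈ W, (n : ℝ) / 2 ≤ ‖G^[n] w‖ ^ 2 := by
  have : ∀ w ∈ W, G^[n] w ∈ W ∧ (n : ℝ) / 2 ≤ ‖G^[n] w‖ ^ 2 := by
    induction n with
    | zero => intro w hw; refine ⟨hw, ?_⟩; simp
    | succ n ih =>
      intro w hw
      obtain ⟨h1, h2⟩ := ih w hw
      rw [Function.iterate_succ_apply']
      refine ⟨hG h1, ?_⟩
      have := hgr _ h1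
      push_cast
      linarith
  exact fun w hw => (this w hw).2

theorem core (m : ℕ) (W : Set ℂ) (hWo : IsOpen W) (G : ℂ → ℂ) (Q : ℂ × ℂ → ℂ × ℂ)
    (φ0 : ℂ → ℂ × ℂ) (hG : Set.MapsTo G W W) (hW : ∀ w ∈ W, 1 ≤ ‖w‖)
    (hgr : ∀ w ∈ W, ‖w‖ ^ 2 + 1 / 2 ≤ ‖G w‖ ^ 2)
    (hinv : ∀ w ∈ W, ∀ z, NN (G w) (z - φ0 (G w)) ≤ (‖G w‖ ^ (m + 1))⁻¹ →
      NN w (Q z - φ0 w) ≤ (‖w‖ ^ (m + 1))⁻¹)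
    (hcon : ∀ w ∈ W, ∀ z₁ z₂, NN (G w) (z₁ - φ0 (G w)) ≤ (‖G w‖ ^ (m + 1))⁻¹ →
      NN (G w) (z₂ - φ0 (G w)) ≤ (‖G w‖ ^ (m + 1))⁻¹ →
      ‖w‖ ^ m * NN w (Q z₁ - Q z₂) ≤ ‖G w‖ ^ m * NN (G w) (z₁ - z₂))
    (hφ0 : DifferentiableOn ℂ φ0 W) (hGd : DifferentiableOn ℂ G W)
    (hQd : ∀ w ∈ W, ∀ z, NN w (z - φ0 w) ≤ (‖w‖ ^ (m + 1))⁻¹ → DifferentiableAt ℂ Q z) :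
    ∃ φ : ℂ → ℂ × ℂ, DifferentiableOn ℂ φ W ∧ ∀ w ∈ W,
      NN w (φ w - φ0 w) ≤ (‖w‖ ^ (m + 1))⁻¹ ∧ Q (φ (G w)) = φ w := by
  set F := itr G Q φ0 with hF
  have hB : ∀ n, ∀ w ∈ W, NN w (F n w - φ0 w) ≤ (‖w‖ ^ (m + 1))⁻¹ := by
    intro n
    induction n with
    | zero =>
      intro w hw
      simp only [hF, itr, sub_self, NN_zero]
      positivity
    | succ n ih => exact fun w hw => hinv w hw _ (ih _ (hG hw))
  have hD : ∀ n, DifferentiableOn ℂ (F n) W := by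
    intro n
    induction n with
    | zero => exact hφ0
    | succ n ih =>
      intro w hw
      have h1 : DifferentiableAt ℂ G w := (hGd w hw).differentiableAt (hWo.mem_nhds hw)
      have h2 : DifferentiableAt ℂ (F n) (G w) :=
        (ih _ (hG hw)).differentiableAt (hWo.mem_nhds (hG hw))
      have h3 := hQd _ (hG hw) _ (hB n _ (hG hw))
      have h4 : DifferentiableAt ℂ (fun w => Q (F n (G w))) w :=
        DifferentiableAt.comp (g := Q) (f := fun w => F n (G w)) w h3
          (DifferentiableAt.comp (g := F n) (f := G) w h2 h1)
      exact h4.differentiableWithinAt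
  have hC : ∀ n, ∀ w ∈ W, ∀ j, ‖w‖ ^ m * NN w (F (n + j) w - F n w) ≤ ‖G^[n] w‖⁻¹ := by
    intro n
    induction n with
    | zero =>
      intro w hw j
      have h1 := hB j w hw
      have hw0 : 0 < ‖w‖ := by linarith [hW w hw]
      simp only [Nat.zero_add, Function.iterate_zero, id]
      calc ‖w‖ ^ m * NN w (F j w - F 0 w) ≤ ‖w‖ ^ m * (‖w‖ ^ (m + 1))⁻¹ := by
            apply mul_le_mul_of_nonneg_left h1; positivity
        _ = ‖w‖⁻¹ := by rw [pow_succ]; field_simp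
    | succ n ih =>
      intro w hw j
      have h1 := hcon w hw _ _ (hB (n + j) _ (hG hw)) (hB n _ (hG hw))
      have h2 := ih _ (hG hw) j
      rw [Function.iterate_succ_apply]
      have : n + 1 + j = (n + j) + 1 := by ring
      rw [this]
      exact h1.trans h2
  have hC' : ∀ n, ∀ w ∈ W, ∀ j, ‖F (n + j) w - F n w‖ ≤ ‖G^[n] w‖⁻¹ := by
    intro n w hw j
    refine le_trans (norm_le_NN (hW w hw) _) (le_trans ?_ (hC n w hw j))
    exact le_mul_of_one_le_left (NN_nonneg _ _) (one_le_pow₀ (hW w hw))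
  have hsm : ∀ ε > 0, ∃ N : ℕ, ∀ n ≥ N, ∀ w ∈ W, ‖G^[n] w‖⁻¹ < ε := by
    intro ε hε
    obtain ⟨N, hN⟩ := exists_nat_gt (2 * (ε⁻¹) ^ 2)
    refine ⟨N, fun n hn w hw => ?_⟩
    have h1 := growth_iter hG hgr n w hw
    have h2 : (N : ℝ) ≤ n := by exact_mod_cast hn
    have h3 : ε⁻¹ < ‖G^[n] w‖ := by
      apply lt_of_pow_lt_pow_left₀ 2 (norm_nonneg _)
      linarith
    exact inv_lt_of_inv_lt₀ hε h3
  have hUC : UniformCauchySeqOn F atTop W := by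
    rw [Metric.uniformCauchySeqOn_iff]
    intro ε hε
    obtain ⟨N, hN⟩ := hsm (ε / 2) (by linarith)
    refine ⟨N, fun i hi j hj w hw => ?_⟩
    obtain ⟨i', rfl⟩ := Nat.exists_eq_add_of_le hi
    obtain ⟨j', rfl⟩ := Nat.exists_eq_add_of_le hj
    have h1 := hC' N w hw i'
    have h2 := hC' N w hw j'
    have h3 := hN N le_rfl w hw
    calc dist (F (N + i') w) (F (N + j') w)
        ≤ dist (F (N + i') w) (F N w) + dist (F (N + j') w) (F N w) := dist_triangle_right _ _ _
      _ < ε := by rw [dist_eq_norm, dist_eq_norm]; linarith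
  have hlim : ∀ w ∈ W, ∃ l, Tendsto (fun n => F n w) atTop (𝓝 l) := by
    intro w hw
    exact cauchySeq_tendsto_of_complete (hUC.cauchySeq hw)
  choose! φ hφ using hlim
  have hTU : TendstoUniformlyOn F φ atTop W :=
    hUC.tendstoUniformlyOn_of_tendsto (fun w hw => hφ w hw)
  have hφB : ∀ w ∈ W, NN w (φ w - φ0 w) ≤ (‖w‖ ^ (m + 1))⁻¹ := by
    intro w hw
    have : Tendsto (fun n => NN w (F n w - φ0 w)) atTop (𝓝 (NN w (φ w - φ0 w))) :=
      ((NN_continuous w).tendsto _).comp ((hφ w hw).sub_const _)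
    exact le_of_tendsto' this (fun n => hB n w hw)
  refine ⟨φ, ?_, fun w hw => ⟨hφB w hw, ?_⟩⟩
  · exact hTU.tendstoLocallyUniformlyOn.differentiableOn (Eventually.of_forall hD) hWo
  · have h1 : Tendsto (fun n => Q (F n (G w))) atTop (𝓝 (Q (φ (G w)))) :=
      ((hQd _ (hG hw) _ (hφB _ (hG hw))).continuousAt.tendsto).comp (hφ _ (hG hw))
    have h2 : Tendsto (fun n => F (n + 1) w) atTop (𝓝 (φ w)) :=
      (hφ w hw).comp (tendsto_add_atTop_nat 1)
    exact tendsto_nhds_unique h1 h2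
open Asymptotics in
theorem coef_exists {f : ℂ → ℂ} (hf : AnalyticAt ℂ f 0) (n : ℕ)
    (hO : f =O[𝓝 0] fun s : ℂ => s ^ n) :
    ∃ r : ℂ, (fun s => f s - r * s ^ n) =O[𝓝 0] fun s : ℂ => s ^ (n + 1) := by
  have key : (n : ℕ∞) ≤ analyticOrderAt f 0 := by
    by_contra hlt
    push Not at hlt
    obtain ⟨k, hk⟩ := ENat.ne_top_iff_exists.mp (ne_top_of_lt hlt)
    rw [← hk] at hlt
    have hkn : k < n := by exact_mod_cast hlt
    obtain ⟨g, hg, hg0, hfg⟩ := (hf.analyticOrderAt_eq_natCast (n := k)).mp hk.symm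
    have h1 : g =O[𝓝[≠] 0] fun s : ℂ => s ^ (n - k) := by
      obtain ⟨C, hC⟩ := hO.bound
      refine IsBigO.of_bound C ?_
      filter_upwards [hC.filter_mono nhdsWithin_le_nhds, hfg.filter_mono nhdsWithin_le_nhds,
        self_mem_nhdsWithin] with s h1 h2 h3
      have h3 : s ≠ 0 := h3
      have h4 : 0 < ‖s‖ ^ k := by positivity
      rw [h2] at h1
      simp only [sub_zero, smul_eq_mul, norm_mul, norm_pow] at h1 ⊢
      have : ‖s‖ ^ n = ‖s‖ ^ k * ‖s‖ ^ (n - k) := by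
        rw [← pow_add]; congr 1; omega
      rw [this] at h1
      have : ‖s‖ ^ k * ‖g s‖ ≤ ‖s‖ ^ k * (C * ‖s‖ ^ (n - k)) := by linarith
      exact le_of_mul_le_mul_left this h4
    have h2 : Tendsto (fun s : ℂ => s ^ (n - k)) (𝓝[≠] 0) (𝓝 0) := by
      have : Continuous fun s : ℂ => s ^ (n - k) := by fun_prop
      have h := this.tendsto 0
      rw [zero_pow (by omega)] at h
      exact h.mono_left nhdsWithin_le_nhds
    have h3 := h1.trans_tendsto h2
    have h4 : Tendsto g (𝓝[≠] 0) (𝓝 (g 0)) := hg.continuousAt.tendsto.mono_left nhdsWithin_le_nhds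
    exact hg0 (tendsto_nhds_unique h4 h3)
  obtain ⟨g, hg, hfg⟩ := (natCast_le_analyticOrderAt hf).mp key
  refine ⟨g 0, ?_⟩
  have h1 : (fun s => g s - g 0) =O[𝓝 0] fun s : ℂ => s := by
    simpa using hg.differentiableAt.hasDerivAt.isBigO_sub
  have h2 := (isBigO_refl (fun s : ℂ => s ^ n) (𝓝 0)).mul h1
  refine h2.congr' ?_ ?_
  · filter_upwards [hfg] with s hs
    rw [hs]; simp; ring
  · exact Eventually.of_forall fun s => by simp [pow_succ]

def kk (b : ℂ × ℂ → ℂ) (p : ℂ → ℂ) (s : ℂ) : ℂ :=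
  (1 + (- s ^ 2 + s ^ 4 * b (p s, s ^ 2))) ^ (1 / 2 : ℂ)

def EE (c : ℂ) (a b : ℂ × ℂ → ℂ) (p : ℂ → ℂ) (s : ℂ) : ℂ :=
  p s + c * s ^ 2 + (p s) ^ 2 + (p s) ^ 3 * a (p s, s ^ 2) - p (s * kk b p s)

theorem uu_analytic {b : ℂ × ℂ → ℂ} (hb : AnalyticAt ℂ b 0) {p : ℂ → ℂ} (hp : AnalyticAt ℂ p 0)
    (hp0 : p 0 = 0) : AnalyticAt ℂ (fun s : ℂ => b (p s, s ^ 2)) 0 := by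
  have h1 : AnalyticAt ℂ (fun s : ℂ => (p s, s ^ 2)) 0 := hp.prod (by fun_prop)
  refine AnalyticAt.fun_comp (g := b) ?_ h1
  have : ((p 0, (0:ℂ) ^ 2) : ℂ × ℂ) = 0 := by simp [hp0]
  rw [this]; exact hb

theorem kk_analytic {b : ℂ × ℂ → ℂ} (hb : AnalyticAt ℂ b 0) {p : ℂ → ℂ} (hp : AnalyticAt ℂ p 0)
    (hp0 : p 0 = 0) : AnalyticAt ℂ (kk b p) 0 := by
  have h1 := uu_analytic hb hp hp0
  unfold kk
  refine AnalyticAt.cpow ?_ analyticAt_const ?_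
  · have h2 : AnalyticAt ℂ (fun s : ℂ => s ^ 2) 0 := by fun_prop
    have h3 : AnalyticAt ℂ (fun s : ℂ => s ^ 4) 0 := by fun_prop
    exact analyticAt_const.add (h2.neg.add (h3.mul h1))
  · simp

theorem EE_analytic {a b : ℂ × ℂ → ℂ} (c : ℂ) (ha : AnalyticAt ℂ a 0) (hb : AnalyticAt ℂ b 0)
    {p : ℂ → ℂ} (hp : AnalyticAt ℂ p 0)
    (hp0 : p 0 = 0) : AnalyticAt ℂ (EE c a b p) 0 := by
  have h1 := uu_analytic ha hp hp0
  have h2 := kk_analytic hb hp hp0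
  have h3 : AnalyticAt ℂ (fun s => p (s * kk b p s)) 0 := by
    refine AnalyticAt.fun_comp (g := p) ?_ ?_
    · simpa using hp
    · fun_prop
  have h4 : AnalyticAt ℂ (fun s => p s + c * s ^ 2 + (p s) ^ 2) 0 := by fun_prop
  exact (h4.add ((hp.pow 3).mul h1)).sub h3

open Asymptotics

theorem bigO_pow_mono {m n : ℕ} (h : n ≤ m) :
    (fun s : ℂ => s ^ m) =O[𝓝 0] fun s : ℂ => s ^ n := by
  have h1 : (fun s : ℂ => s ^ (m - n)) =O[𝓝 0] fun _ : ℂ => (1 : ℂ) := by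
    have : Continuous fun s : ℂ => s ^ (m - n) := by fun_prop
    exact (this.tendsto 0).isBigO_one ℂ
  have := (isBigO_refl (fun s : ℂ => s ^ n) (𝓝 0)).mul h1
  simpa [← pow_add, Nat.add_sub_cancel' h] using this

theorem uu_bigO {b : ℂ × ℂ → ℂ} (hb : AnalyticAt ℂ b 0) {p : ℂ → ℂ} (hp : AnalyticAt ℂ p 0)
    (hp0 : p 0 = 0) : (fun s : ℂ => - s ^ 2 + s ^ 4 * b (p s, s ^ 2)) =O[𝓝 0] fun s : ℂ => s ^ 2 := by
  have h1 := uu_analytic hb hp hp0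
  have h2 := h1.continuousAt.isBigO_one (F := ℂ)
  have h3 := (isBigO_refl (fun s : ℂ => s ^ 4) (𝓝 0)).mul h2
  simp only [mul_one] at h3
  exact (isBigO_refl (fun s : ℂ => s ^ 2) (𝓝 0)).neg_left.add (h3.trans (bigO_pow_mono (by norm_num)))

theorem uu_tendsto {b : ℂ × ℂ → ℂ} (hb : AnalyticAt ℂ b 0) {p : ℂ → ℂ} (hp : AnalyticAt ℂ p 0)
    (hp0 : p 0 = 0) : Tendsto (fun s : ℂ => - s ^ 2 + s ^ 4 * b (p s, s ^ 2)) (𝓝 0) (𝓝 0) := by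
  have h1 := uu_analytic hb hp hp0
  have h2 : ContinuousAt (fun s : ℂ => - s ^ 2 + s ^ 4 * b (p s, s ^ 2)) 0 := by
    have h2 : AnalyticAt ℂ (fun s : ℂ => s ^ 2) 0 := by fun_prop
    have h3 : AnalyticAt ℂ (fun s : ℂ => s ^ 4) 0 := by fun_prop
    exact (h2.neg.add (h3.mul h1)).continuousAt
  simpa using h2.tendsto

theorem cp_analytic (e : ℂ) : AnalyticAt ℂ (fun u : ℂ => (1 + u) ^ e) 0 := by
  refine AnalyticAt.cpow (by fun_prop) analyticAt_const (by simp)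

theorem kk_pow_bigO {b : ℂ × ℂ → ℂ} (hb : AnalyticAt ℂ b 0) {p : ℂ → ℂ} (hp : AnalyticAt ℂ p 0)
    (hp0 : p 0 = 0) (n : ℕ) : (fun s : ℂ => (kk b p s) ^ n - 1) =O[𝓝 0] fun s : ℂ => s ^ 2 := by
  have h1 : (fun u : ℂ => ((1 + u) ^ (1 / 2 : ℂ)) ^ n - 1) =O[𝓝 0] fun u : ℂ => u := by
    have h : AnalyticAt ℂ (fun u : ℂ => ((1 + u) ^ (1 / 2 : ℂ)) ^ n) 0 := (cp_analytic _).pow n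
    simpa using h.differentiableAt.hasDerivAt.isBigO_sub
  exact (h1.comp_tendsto (uu_tendsto hb hp hp0)).trans (uu_bigO hb hp hp0)

theorem lip_comp {E : Type*} [NormedAddCommGroup E] [NormedSpace ℂ E] {f : E → ℂ}
    (hf : AnalyticAt ℂ f 0) {u v : ℂ → E} (hu : Tendsto u (𝓝 0) (𝓝 0))
    (hv : Tendsto v (𝓝 0) (𝓝 0)) :
    (fun s => f (u s) - f (v s)) =O[𝓝 0] fun s => u s - v s := by
  have h := hf.hasStrictFDerivAt.isBigO_sub
  have ht : Tendsto (fun s => (u s, v s)) (𝓝 0) (𝓝 ((0 : E), (0 : E))) := hu.prodMk_nhds hv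
  exact h.comp_tendsto ht

theorem tendsto_of_analytic {E : Type*} [NormedAddCommGroup E] [NormedSpace ℂ E] {u : ℂ → E}
    (hu : AnalyticAt ℂ u 0) (h0 : u 0 = 0) : Tendsto u (𝓝 0) (𝓝 0) := by
  simpa [h0] using hu.continuousAt.tendsto

theorem ser_step {a b : ℂ × ℂ → ℂ} (c c1 : ℂ) (hc1 : c1 ≠ 0) (ha : AnalyticAt ℂ a 0)
    (hb : AnalyticAt ℂ b 0) {p : ℂ → ℂ} (hp : AnalyticAt ℂ p 0) (n : ℕ) (hn : 1 ≤ n)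
    (hpc : (fun s => p s - c1 * s) =O[𝓝 0] fun s : ℂ => s ^ 2)
    (hE : EE c a b p =O[𝓝 0] fun s : ℂ => s ^ (n + 2)) :
    ∃ e : ℂ, EE c a b (fun s => p s + e * s ^ (n + 1)) =O[𝓝 0] fun s : ℂ => s ^ (n + 3) := by
  have hp0 : p 0 = 0 := by
    have h := hpc.bound
    obtain ⟨C, hC⟩ := h
    have := hC.self_of_nhds
    simpa using this
  obtain ⟨r, hr⟩ := coef_exists (EE_analytic c ha hb hp hp0) (n + 2) hE
  refine ⟨- r / (2 * c1), ?_⟩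
  set e := - r / (2 * c1) with he
  have her : r = - (2 * c1 * e) := by rw [he]; field_simp
  set q : ℂ → ℂ := fun s => e * s ^ (n + 1) with hq
  set p' : ℂ → ℂ := fun s => p s + e * s ^ (n + 1) with hp'
  have hp'a : AnalyticAt ℂ p' 0 := by fun_prop
  have hp'0 : p' 0 = 0 := by simp [hp', hp0]
  have hqO : q =O[𝓝 0] fun s : ℂ => s ^ (n + 1) := (isBigO_refl _ _).const_mul_left e
  have hpO : p =O[𝓝 0] fun s : ℂ => s ^ 1 := by
    have := hp.differentiableAt.hasDerivAt.isBigO_sub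
    simpa [hp0] using this
  have hp'O : p' =O[𝓝 0] fun s : ℂ => s ^ 1 := hpO.add (hqO.trans (bigO_pow_mono (by omega)))
  have hz1 : Tendsto (fun s : ℂ => (p s, s ^ 2)) (𝓝 0) (𝓝 0) :=
    tendsto_of_analytic (hp.prod (by fun_prop)) (by simp [hp0])
  have hz2 : Tendsto (fun s : ℂ => (p' s, s ^ 2)) (𝓝 0) (𝓝 0) :=
    tendsto_of_analytic (hp'a.prod (by fun_prop)) (by simp [hp'0])
  have hdiff : (fun s : ℂ => (p' s, s ^ 2) - (p s, s ^ 2)) =O[𝓝 0] fun s : ℂ => s ^ (n + 1) := by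
    have : (fun s : ℂ => (p' s, s ^ 2) - (p s, s ^ 2)) = fun s : ℂ => (q s, (0 : ℂ)) := by
      funext s; simp [hp', hq]
    rw [this]
    exact hqO.prod_left (isBigO_zero _ _)
  have ha' := (lip_comp ha hz2 hz1).trans hdiff
  have hb' := (lip_comp hb hz2 hz1).trans hdiff
  -- pieces
  have t1 : (fun s => 2 * ((p s - c1 * s) * q s)) =O[𝓝 0] fun s : ℂ => s ^ (n + 3) := by
    have := (hpc.mul hqO).const_mul_left 2
    refine this.trans_eventuallyEq (Eventually.of_forall fun s => ?_)
    ring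
  have t2 : (fun s => q s * q s) =O[𝓝 0] fun s : ℂ => s ^ (n + 3) := by
    have := hqO.mul hqO
    simp only [← pow_add] at this
    exact this.trans (bigO_pow_mono (by omega))
  have t3 : (fun s => q s * (p' s * p' s + p' s * p s + p s * p s) * a (p' s, s ^ 2)) =O[𝓝 0]
      fun s : ℂ => s ^ (n + 3) := by
    have h1 := ((hp'O.mul hp'O).add (hp'O.mul hpO)).add (hpO.mul hpO)
    have h2 := (uu_analytic ha hp'a hp'0).continuousAt.isBigO_one (F := ℂ)
    have h3 := (hqO.mul h1).mul h2
    refine h3.trans_eventuallyEq (Eventually.of_forall fun s => ?_)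
    ring
  have t4 : (fun s => p s * p s * p s * (a (p' s, s ^ 2) - a (p s, s ^ 2))) =O[𝓝 0]
      fun s : ℂ => s ^ (n + 3) := by
    have h3 := ((hpO.mul hpO).mul hpO).mul ha'
    simp only [← pow_add] at h3
    exact h3.trans (bigO_pow_mono (by omega))
  have t5 : (fun s => e * (s ^ (n + 1) * ((kk b p' s) ^ (n + 1) - 1))) =O[𝓝 0]
      fun s : ℂ => s ^ (n + 3) := by
    have h3 := ((isBigO_refl (fun s : ℂ => s ^ (n + 1)) (𝓝 0)).mul
      (kk_pow_bigO hb hp'a hp'0 (n + 1))).const_mul_left e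
    simp only [← pow_add] at h3
    exact h3
  have t6 : (fun s => p (s * kk b p' s) - p (s * kk b p s)) =O[𝓝 0]
      fun s : ℂ => s ^ (n + 3) := by
    have k1 := kk_analytic hb hp hp0
    have k2 := kk_analytic hb hp'a hp'0
    have h1 : Tendsto (fun s => s * kk b p s) (𝓝 0) (𝓝 0) :=
      tendsto_of_analytic (by fun_prop) (by simp)
    have h2 : Tendsto (fun s => s * kk b p' s) (𝓝 0) (𝓝 0) :=
      tendsto_of_analytic (by fun_prop) (by simp)
    have h3 := lip_comp hp h2 h1
    have h4 := lip_comp (cp_analytic (1 / 2)) (uu_tendsto hb hp'a hp'0) (uu_tendsto hb hp hp0)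
    have h5 := (isBigO_refl (fun s : ℂ => s ^ 4) (𝓝 0)).mul hb'
    have h6 : (fun s => kk b p' s - kk b p s) =O[𝓝 0] fun s : ℂ => s ^ 4 * s ^ (n + 1) := by
      refine (h4.congr_right (fun s => ?_)).trans h5
      ring
    have h7 := (isBigO_refl (fun s : ℂ => s ^ 1) (𝓝 0)).mul h6
    simp only [← pow_add] at h7
    refine h3.trans ((h7.congr_left (fun s => ?_)).trans (bigO_pow_mono (by omega)))
    ring
  have tot := ((((((hr.add t1).add t2).add t3).add t4).sub t5).sub t6)
  refine tot.congr_left (fun s => ?_)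
  simp only [EE, hp', hq, her, mul_pow]
  ring

theorem kk_bigO {b : ℂ × ℂ → ℂ} (hb : AnalyticAt ℂ b 0) {p : ℂ → ℂ} (hp : AnalyticAt ℂ p 0)
    (hp0 : p 0 = 0) : (fun s : ℂ => kk b p s - 1) =O[𝓝 0] fun s : ℂ => s ^ 2 := by
  simpa using kk_pow_bigO hb hp hp0 1

theorem ser_base {a b : ℂ × ℂ → ℂ} (c c1 : ℂ) (hc : c1 ^ 2 = - c) (ha : AnalyticAt ℂ a 0)
    (hb : AnalyticAt ℂ b 0) :
    EE c a b (fun s => c1 * s) =O[𝓝 0] fun s : ℂ => s ^ 3 := by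
  have hp : AnalyticAt ℂ (fun s : ℂ => c1 * s) 0 := by fun_prop
  have hp0 : (fun s : ℂ => c1 * s) 0 = 0 := by simp
  have h1 := kk_bigO hb hp hp0
  have h2 := (uu_analytic ha hp hp0).continuousAt.isBigO_one (F := ℂ)
  have h3 := ((isBigO_refl (fun s : ℂ => s ^ 3) (𝓝 0)).mul h2).const_mul_left (c1 ^ 3)
  have h4 := ((isBigO_refl (fun s : ℂ => s ^ 1) (𝓝 0)).mul h1).const_mul_left c1
  simp only [← pow_add, mul_one] at h3 h4
  refine (h3.sub h4).congr_left (fun s => ?_)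
  have : c = - c1 ^ 2 := by rw [hc]; ring
  simp only [EE, this]
  ring

theorem ser_exists {a b : ℂ × ℂ → ℂ} (c c1 : ℂ) (hc1 : c1 ≠ 0) (hc : c1 ^ 2 = - c)
    (ha : AnalyticAt ℂ a 0) (hb : AnalyticAt ℂ b 0) :
    ∃ c2 : ℂ, ∀ K : ℕ, ∃ p : ℂ → ℂ, AnalyticAt ℂ p 0 ∧ p 0 = 0 ∧
      ((fun s => p s - c1 * s - c2 * s ^ 2) =O[𝓝 0] fun s : ℂ => s ^ 3) ∧
      EE c a b p =O[𝓝 0] fun s : ℂ => s ^ K := by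
  obtain ⟨c2, h2⟩ := ser_step (p := fun s => c1 * s) c c1 hc1 ha hb (by fun_prop) 1 le_rfl
    (by simpa using isBigO_zero _ _) (ser_base c c1 hc ha hb)
  refine ⟨c2, ?_⟩
  have : ∀ K : ℕ, ∃ p : ℂ → ℂ, AnalyticAt ℂ p 0 ∧ p 0 = 0 ∧
      ((fun s => p s - c1 * s - c2 * s ^ 2) =O[𝓝 0] fun s : ℂ => s ^ 3) ∧
      EE c a b p =O[𝓝 0] fun s : ℂ => s ^ (K + 4) := by
    intro K
    induction K with
    | zero =>
      refine ⟨fun s => c1 * s + c2 * s ^ (1 + 1), by fun_prop, by simp, ?_, h2⟩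
      simpa using isBigO_zero _ _
    | succ K ih =>
      obtain ⟨p, hp, hp0, h1, h3⟩ := ih
      have h4 : (fun s => p s - c1 * s) =O[𝓝 0] fun s : ℂ => s ^ 2 := by
        have := (h1.trans (bigO_pow_mono (n := 2) (by norm_num))).add
          ((isBigO_refl (fun s : ℂ => s ^ 2) (𝓝 0)).const_mul_left c2)
        refine this.congr_left (fun s => ?_)
        ring
      obtain ⟨e, he⟩ := ser_step c c1 hc1 ha hb hp (K + 2) (by omega) h4 h3
      refine ⟨fun s => p s + e * s ^ (K + 2 + 1), by fun_prop, by simp [hp0], ?_, ?_⟩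
      · have := h1.add (((bigO_pow_mono (m := K + 2 + 1) (n := 3) (by omega))).const_mul_left e)
        refine this.congr_left (fun s => ?_)
        ring
      · exact he
  intro K
  obtain ⟨p, h1, h2, h3, h4⟩ := this K
  exact ⟨p, h1, h2, h3, h4.trans (bigO_pow_mono (by omega))⟩
theorem kk_inv_bigO {b : ℂ × ℂ → ℂ} (hb : AnalyticAt ℂ b 0) {p : ℂ → ℂ} (hp : AnalyticAt ℂ p 0)
    (hp0 : p 0 = 0) :
    (fun s : ℂ => (kk b p s)⁻¹ - 1 - s ^ 2 / 2) =O[𝓝 0] fun s : ℂ => s ^ 4 := by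
  have h1 := kk_bigO hb hp hp0
  have hk0 : kk b p 0 = 1 := by simp [kk]
  have hkc : ContinuousAt (kk b p) 0 := (kk_analytic hb hp hp0).continuousAt
  have hne : ∀ᶠ s in 𝓝 0, kk b p s ≠ 0 := hkc.eventually_ne (by simp [hk0])
  have hinv := (hkc.inv₀ (by simp [hk0])).isBigO_one (F := ℂ)
  have h2 := h1.mul h1
  simp only [← pow_add] at h2
  have h3 := (uu_analytic hb hp hp0).continuousAt.isBigO_one (F := ℂ)
  have h4 := (isBigO_refl (fun s : ℂ => s ^ 4) (𝓝 0)).mul h3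
  have h5 := h2.mul hinv
  simp only [mul_one] at h4 h5
  have tot := ((h2.const_mul_left (1 / 2)).sub (h4.const_mul_left (1 / 2))).add h5
  refine tot.congr' ?_ (Eventually.of_forall fun s => rfl)
  filter_upwards [hne] with s hs
  have hsq : (kk b p s) ^ 2 = 1 + (- s ^ 2 + s ^ 4 * b (p s, s ^ 2)) := by
    unfold kk
    have := Complex.cpow_nat_inv_pow (1 + (- s ^ 2 + s ^ 4 * b (p s, s ^ 2))) (n := 2) (by norm_num)
    simpa using this
  have hu : s ^ 4 * b (p s, s ^ 2) = (kk b p s) ^ 2 - 1 + s ^ 2 := by rw [hsq]; ring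
  rw [hu]
  simp only [Pi.inv_apply]
  field_simp
  ring

theorem orb {κ : ℂ → ℂ} (hκ : (fun s : ℂ => κ s - 1 - s ^ 2 / 2) =O[𝓝 0] fun s : ℂ => s ^ 4) :
    ∃ R0 : ℝ, ∀ w : ℂ, R0 < w.re → |w.im| ≤ 1 →
      w.re < (w * κ w⁻¹).re ∧
      (∀ η : ℝ, 1 / 2 ≤ η → |w.im| < η → |(w * κ w⁻¹).im| < η) ∧
      ‖w‖ * (1 + ‖w‖⁻¹ ^ 2 / 4) ≤ ‖w * κ w⁻¹‖ := by
  obtain ⟨C, hCpos, hC⟩ := hκ.exists_pos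
  rw [isBigOWith_iff] at hC
  obtain ⟨δ, hδ, hCδ⟩ := Metric.eventually_nhds_iff.mp hC
  refine ⟨max 1 (max δ⁻¹ (4 * (C + 1))), fun w hw him => ?_⟩
  have hw1 : 1 < w.re := (le_max_left _ _).trans_lt hw
  have hwδ : δ⁻¹ < w.re := ((le_max_left _ _).trans (le_max_right _ _)).trans_lt hw
  have hwC : 4 * (C + 1) < w.re := ((le_max_right _ _).trans (le_max_right _ _)).trans_lt hw
  have hren : w.re ≤ ‖w‖ := Complex.re_le_norm w
  have hn0 : 0 < ‖w‖ := by linarith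
  have hw0 : w ≠ 0 := norm_pos_iff.mp hn0
  set σ := ‖w‖⁻¹ with hσ
  have hσ0 : 0 < σ := inv_pos.mpr hn0
  have hσw : σ * ‖w‖ = 1 := inv_mul_cancel₀ hn0.ne'
  have hs : ‖w⁻¹‖ = σ := norm_inv w
  have hσ1 : σ ≤ 1 := inv_le_one_of_one_le₀ (by linarith)
  have hσC : 4 * (C + 1) * σ ≤ 1 := by
    calc 4 * (C + 1) * σ ≤ ‖w‖ * σ := by gcongr; linarith
      _ = 1 := by rw [mul_comm]; exact hσw
  have hρ : ‖κ w⁻¹ - 1 - w⁻¹ ^ 2 / 2‖ ≤ C * σ ^ 4 := by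
    have := hCδ (y := w⁻¹) (by
      rw [dist_zero_right, hs]
      exact inv_lt_of_inv_lt₀ hδ (by linarith))
    rwa [norm_pow, hs] at this
  set ρ := κ w⁻¹ - 1 - w⁻¹ ^ 2 / 2 with hρd
  have hκe : κ w⁻¹ = 1 + w⁻¹ ^ 2 / 2 + ρ := by rw [hρd]; ring
  have hwe : w * κ w⁻¹ = w + w⁻¹ / 2 + w * ρ := by rw [hκe]; field_simp
  have hwρ : ‖w * ρ‖ ≤ C * σ ^ 3 := by
    rw [norm_mul]
    calc ‖w‖ * ‖ρ‖ ≤ ‖w‖ * (C * σ ^ 4) := by gcongr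
      _ = C * σ ^ 3 * (σ * ‖w‖) := by ring
      _ = C * σ ^ 3 := by rw [hσw, mul_one]
  have hnsq : Complex.normSq w = ‖w‖ ^ 2 := Complex.normSq_eq_norm_sq w
  have hre : (w⁻¹).re = w.re * σ ^ 2 := by
    rw [Complex.inv_re, hnsq, hσ]; field_simp
  have him' : (w⁻¹).im = - w.im * σ ^ 2 := by
    rw [Complex.inv_im, hnsq, hσ]; field_simp
  have hCσ3 : C * σ ^ 3 < σ ^ 2 / 4 := by
    have : 0 < σ ^ 2 := by positivity
    nlinarith
  have hre2 : (w⁻¹ / 2).re = w.re * σ ^ 2 / 2 := by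
    rw [← hre]; simp
  have him2 : (w⁻¹ / 2).im = - w.im * σ ^ 2 / 2 := by
    rw [← him']; simp
  refine ⟨?_, ?_, ?_⟩
  · rw [hwe, Complex.add_re, Complex.add_re, hre2]
    have h1 := (abs_le.mp ((Complex.abs_re_le_norm (w * ρ)).trans hwρ)).1
    have : 0 < σ ^ 2 := by positivity
    nlinarith
  · intro η hη hlt
    rw [hwe, Complex.add_im, Complex.add_im, him2]
    have h1 := (Complex.abs_im_le_norm (w * ρ)).trans hwρ
    have h2 : 0 < σ ^ 2 := by positivity
    have h2' : σ ^ 2 ≤ 1 := pow_le_one₀ hσ0.le hσ1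
    have h3 : w.im + -w.im * σ ^ 2 / 2 = w.im * (1 - σ ^ 2 / 2) := by ring
    rw [h3]
    calc |w.im * (1 - σ ^ 2 / 2) + (w * ρ).im| ≤ |w.im * (1 - σ ^ 2 / 2)| + |(w * ρ).im| :=
          abs_add_le _ _
      _ ≤ |w.im| * (1 - σ ^ 2 / 2) + C * σ ^ 3 := by
          rw [abs_mul, abs_of_nonneg (a := 1 - σ ^ 2 / 2) (by linarith)]; linarith
      _ < η := by nlinarith
  · rw [norm_mul]
    apply mul_le_mul_of_nonneg_left _ hn0.le
    refine le_trans ?_ (Complex.re_le_norm _)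
    rw [hκe, Complex.add_re, Complex.add_re, Complex.one_re]
    have h1 := (abs_le.mp ((Complex.abs_re_le_norm ρ).trans hρ)).1
    have h2 : (w⁻¹ ^ 2 / 2).re = (σ ^ 2 - 2 * (w.im * σ ^ 2) ^ 2) / 2 := by
      have e1 : (w⁻¹ ^ 2 / 2).re = ((w⁻¹).re ^ 2 - (w⁻¹).im ^ 2) / 2 := by
        simp [pow_two]
      have e2 : (w⁻¹).re ^ 2 + (w⁻¹).im ^ 2 = σ ^ 2 := by
        rw [← hs, ← Complex.normSq_eq_norm_sq, Complex.normSq_apply]; ring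
      have e3 : (w.im * σ ^ 2) ^ 2 = (w⁻¹).im ^ 2 := by rw [him']; ring
      rw [e1, e3, ← e2]; ring
    rw [h2]
    have h3 : w.im ^ 2 ≤ 1 := by
      rw [← sq_abs]; exact pow_le_one₀ (abs_nonneg _) him
    have h4 : (w.im * σ ^ 2) ^ 2 ≤ σ ^ 4 := by
      have : (0:ℝ) ≤ σ ^ 4 := by positivity
      nlinarith
    have h5 : (C + 1) * σ ^ 4 ≤ σ ^ 2 / 4 := by
      have e : (C + 1) * σ ^ 4 = ((C + 1) * σ) * σ * σ ^ 2 := by ring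
      rw [e]
      have : (C + 1) * σ ≤ 1 / 4 := by linarith
      have : (C + 1) * σ * σ ≤ 1 / 4 := by nlinarith
      have : 0 ≤ σ ^ 2 := by positivity
      nlinarith
    linarith
def PP (c : ℂ) (a b : ℂ × ℂ → ℂ) (z : ℂ × ℂ) : ℂ × ℂ :=
  (z.1 + c * z.2 + z.1 ^ 2 + z.1 ^ 3 * a z, z.2 - z.2 ^ 2 + z.2 ^ 3 * b z)

theorem bdd_lip {a : ℂ × ℂ → ℂ} (ha : AnalyticAt ℂ a 0) : ∃ A > 0, ∃ δ > 0,
    ∀ z₁ z₂ : ℂ × ℂ, ‖z₁‖ < δ → ‖z₂‖ < δ → ‖a z₁‖ ≤ A ∧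
      ‖a z₁ - a z₂‖ ≤ A * (‖z₁.1 - z₂.1‖ + ‖z₁.2 - z₂.2‖) := by
  obtain ⟨K, S, hS, hK⟩ := ha.hasStrictFDerivAt.exists_lipschitzOnWith
  obtain ⟨δ, hδ, hδS⟩ := Metric.mem_nhds_iff.mp hS
  refine ⟨‖a 0‖ + K * δ + K + 1, by positivity, δ, hδ, fun z₁ z₂ h1 h2 => ?_⟩
  have hK0 : (0:ℝ) ≤ K := K.2
  have m1 : z₁ ∈ S := hδS (by simpa using h1)
  have m2 : z₂ ∈ S := hδS (by simpa using h2)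
  have m0 : (0 : ℂ × ℂ) ∈ S := hδS (by simpa using hδ)
  have e1 := hK.dist_le_mul _ m1 _ m2
  have e2 := hK.dist_le_mul _ m1 _ m0
  rw [dist_eq_norm, dist_eq_norm] at e1 e2
  rw [sub_zero] at e2
  have e3 : ‖a z₁‖ ≤ ‖a z₁ - a 0‖ + ‖a 0‖ := by
    simpa using norm_add_le (a z₁ - a 0) (a 0)
  have hn1 := norm_nonneg (z₁.1 - z₂.1)
  have hn2 := norm_nonneg (z₁.2 - z₂.2)
  have e4 : ‖z₁ - z₂‖ ≤ ‖z₁.1 - z₂.1‖ + ‖z₁.2 - z₂.2‖ := by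
    rw [Prod.norm_def]; apply max_le <;> simp
  constructor
  · nlinarith [norm_nonneg (a 0)]
  · refine e1.trans ?_
    have : (K:ℝ) ≤ ‖a 0‖ + K * δ + K + 1 := by
      have : 0 ≤ K * δ := by positivity
      linarith [norm_nonneg (a 0)]
    apply mul_le_mul this e4 (norm_nonneg _) (by positivity)

theorem cube_diff {A X Y B : ℝ} {x₁ x₂ a₁ a₂ : ℂ} (h1 : ‖x₁‖ ≤ B) (h2 : ‖x₂‖ ≤ B)
    (h3 : ‖a₁‖ ≤ A) (h4 : ‖a₁ - a₂‖ ≤ A * Y) (hX : ‖x₁ - x₂‖ = X) (hA : 0 ≤ A) (hB : 0 ≤ B)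
     :
    ‖x₁ ^ 3 * a₁ - x₂ ^ 3 * a₂‖ ≤ 3 * B ^ 2 * A * X + B ^ 3 * A * Y := by
  have e : x₁ ^ 3 * a₁ - x₂ ^ 3 * a₂ =
    (x₁ - x₂) * (x₁ * x₁ + x₁ * x₂ + x₂ * x₂) * a₁ + x₂ ^ 3 * (a₁ - a₂) := by ring
  have hX0 : 0 ≤ X := hX ▸ norm_nonneg _
  have q : ‖x₁ * x₁ + x₁ * x₂ + x₂ * x₂‖ ≤ 3 * B ^ 2 := by
    calc _ ≤ ‖x₁ * x₁‖ + ‖x₁ * x₂‖ + ‖x₂ * x₂‖ := norm_add₃_le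
      _ ≤ B * B + B * B + B * B := by
        simp only [norm_mul]; gcongr
      _ = _ := by ring
  rw [e]
  calc _ ≤ ‖(x₁ - x₂) * (x₁ * x₁ + x₁ * x₂ + x₂ * x₂) * a₁‖ + ‖x₂ ^ 3 * (a₁ - a₂)‖ :=
        norm_add_le _ _
    _ ≤ X * (3 * B ^ 2) * A + B ^ 3 * (A * Y) := by
        rw [norm_mul, norm_mul, norm_mul, norm_pow, hX]
        gcongr
    _ = _ := by ring

set_option maxHeartbeats 1000000 in
theorem expand {a b : ℂ × ℂ → ℂ} (ha : AnalyticAt ℂ a 0) (hb : AnalyticAt ℂ b 0) (c c1 : ℂ)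
    (hc : ‖c‖ ≤ 4) (hc1 : ‖c1‖ ≤ 2) (C0 : ℝ) (hC0 : 0 < C0) :
    ∃ C > 0, ∃ δ > 0, ∀ s : ℂ, 0 < ‖s‖ → ‖s‖ < δ → |(c1 * s).re| ≤ 2 * ‖s‖ ^ 2 →
      ∀ z₁ z₂ : ℂ × ℂ, ‖z₁.1 - c1 * s‖ ≤ C0 * ‖s‖ ^ 2 → ‖z₁.2 - s ^ 2‖ ≤ ‖s‖ ^ 2 →
      ‖z₂.1 - c1 * s‖ ≤ C0 * ‖s‖ ^ 2 → ‖z₂.2 - s ^ 2‖ ≤ ‖s‖ ^ 2 →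
      (1 - C * ‖s‖ ^ 2) * NN s⁻¹ (z₁ - z₂) ≤ NN s⁻¹ (PP c a b z₁ - PP c a b z₂) := by
  obtain ⟨A₁, hA₁, δ₁, hδ₁, H₁⟩ := bdd_lip ha
  obtain ⟨A₂, hA₂, δ₂, hδ₂, H₂⟩ := bdd_lip hb
  refine ⟨100 * (A₁ + A₂) + 2 * C0 + 10, by positivity,
    min 1 (min C0⁻¹ (min (δ₁ / 4) (δ₂ / 4))), by positivity, ?_⟩
  intro s hs0 hs hre z₁ z₂ h11 h12 h21 h22
  simp only [lt_min_iff] at hs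
  obtain ⟨hs1, hsC, hsd1, hsd2⟩ := hs
  set σ := ‖s‖ with hσ
  have hσC : C0 * σ < 1 := by
    calc C0 * σ < C0 * C0⁻¹ := by gcongr
      _ = 1 := mul_inv_cancel₀ hC0.ne'
  have hx : ∀ x : ℂ, ‖x - c1 * s‖ ≤ C0 * σ ^ 2 → ‖x‖ ≤ 3 * σ := by
    intro x hx
    have e1 : ‖x‖ ≤ ‖x - c1 * s‖ + ‖c1 * s‖ := by simpa using norm_add_le (x - c1 * s) (c1 * s)
    rw [norm_mul] at e1
    nlinarith
  have hy : ∀ y : ℂ, ‖y - s ^ 2‖ ≤ σ ^ 2 → ‖y‖ ≤ 2 * σ ^ 2 := by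
    intro y hy
    have e1 : ‖y‖ ≤ ‖y - s ^ 2‖ + ‖s ^ 2‖ := by
      have := norm_add_le (y - s ^ 2) (s ^ 2)
      rwa [sub_add_cancel] at this
    rw [norm_pow] at e1
    linarith
  have x1 := hx _ h11
  have x2 := hx _ h21
  have y1 := hy _ h12
  have y2 := hy _ h22
  have hσσ : σ ^ 2 ≤ σ := by nlinarith
  have n1 : ‖z₁‖ ≤ 3 * σ := by rw [Prod.norm_def]; apply max_le <;> linarith
  have n2 : ‖z₂‖ ≤ 3 * σ := by rw [Prod.norm_def]; apply max_le <;> linarith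
  obtain ⟨a1, a2⟩ := H₁ z₁ z₂ (by linarith) (by linarith)
  obtain ⟨b1, b2⟩ := H₂ z₁ z₂ (by linarith) (by linarith)
  set X := ‖z₁.1 - z₂.1‖ with hX
  set Y := ‖z₁.2 - z₂.2‖ with hY
  have hX0 : 0 ≤ X := norm_nonneg _
  have hY0 : 0 ≤ Y := norm_nonneg _
  have ca := cube_diff x1 x2 a1 a2 rfl hA₁.le (by positivity)
  have cb := cube_diff y1 y2 b1 b2 rfl hA₂.le (by positivity)
  rw [← hX] at ca
  rw [← hY] at cb
  -- multiplier in the first coordinate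
  have mult : 1 - (4 + 2 * C0) * σ ^ 2 ≤ ‖1 + z₁.1 + z₂.1‖ := by
    refine le_trans ?_ (Complex.re_le_norm _)
    have e : 1 + z₁.1 + z₂.1 = 1 + 2 * (c1 * s) + (z₁.1 - c1 * s) + (z₂.1 - c1 * s) := by ring
    rw [e]
    have r1 := (abs_le.mp ((Complex.abs_re_le_norm _).trans h11)).1
    have r2 := (abs_le.mp ((Complex.abs_re_le_norm _).trans h21)).1
    have r3 := (abs_le.mp hre).1
    have e2 : (2 * (c1 * s)).re = 2 * (c1 * s).re := by simp
    rw [Complex.add_re, Complex.add_re, Complex.add_re, e2, Complex.one_re]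
    linarith
  have multy : 1 - 4 * σ ^ 2 ≤ ‖1 - z₁.2 - z₂.2‖ := by
    have e1 : ‖(1:ℂ)‖ ≤ ‖1 - z₁.2 - z₂.2‖ + ‖z₁.2‖ + ‖z₂.2‖ := by
      have := norm_add₃_le (a := 1 - z₁.2 - z₂.2) (b := z₁.2) (c := z₂.2)
      have e : 1 - z₁.2 - z₂.2 + z₁.2 + z₂.2 = 1 := by ring
      rwa [e] at this
    rw [norm_one] at e1
    linarith
  have D1 : (1 - (4 + 2 * C0) * σ ^ 2) * X - 4 * Y -
      (3 * (3 * σ) ^ 2 * A₁ * X + (3 * σ) ^ 3 * A₁ * (X + Y)) ≤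
      ‖(PP c a b z₁ - PP c a b z₂).1‖ := by
    have e : (1 + z₁.1 + z₂.1) * (z₁.1 - z₂.1) = (PP c a b z₁ - PP c a b z₂).1
      + (- (c * (z₁.2 - z₂.2))) + (- (z₁.1 ^ 3 * a z₁ - z₂.1 ^ 3 * a z₂)) := by
      simp only [PP, Prod.fst_sub]; ring
    have t := norm_add₃_le (a := (PP c a b z₁ - PP c a b z₂).1)
      (b := - (c * (z₁.2 - z₂.2))) (c := - (z₁.1 ^ 3 * a z₁ - z₂.1 ^ 3 * a z₂))
    rw [← e, norm_mul, norm_neg, norm_neg, norm_mul] at t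
    have u1 := mul_le_mul_of_nonneg_right mult hX0
    have u2 := mul_le_mul_of_nonneg_right hc hY0
    linarith
  have D2 : (1 - 4 * σ ^ 2) * Y -
      (3 * (2 * σ ^ 2) ^ 2 * A₂ * Y + (2 * σ ^ 2) ^ 3 * A₂ * (X + Y)) ≤
      ‖(PP c a b z₁ - PP c a b z₂).2‖ := by
    have e : (1 - z₁.2 - z₂.2) * (z₁.2 - z₂.2) = (PP c a b z₁ - PP c a b z₂).2
      + (- (z₁.2 ^ 3 * b z₁ - z₂.2 ^ 3 * b z₂)) := by
      simp only [PP, Prod.snd_sub]; ring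
    have t := norm_add_le ((PP c a b z₁ - PP c a b z₂).2)
      (- (z₁.2 ^ 3 * b z₁ - z₂.2 ^ 3 * b z₂))
    rw [← e, norm_mul, norm_neg] at t
    have u1 := mul_le_mul_of_nonneg_right multy hY0
    linarith
  have hinv : ‖s⁻¹‖ ^ 2 = (σ ^ 2)⁻¹ := by rw [norm_inv, inv_pow]
  unfold NN
  rw [hinv, Prod.fst_sub, Prod.snd_sub, ← hX, ← hY]
  have hs2 : 0 < σ ^ 2 := by positivity
  set V := (σ ^ 2)⁻¹ * Y with hV
  have hYV : Y = σ ^ 2 * V := by rw [hV]; field_simp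
  have hV0 : 0 ≤ V := by positivity
  have D2' : (1 - 4 * σ ^ 2) * V -
      (12 * σ ^ 4 * A₂ * V + 8 * σ ^ 4 * A₂ * X + 8 * σ ^ 6 * A₂ * V) ≤
      (σ ^ 2)⁻¹ * ‖(PP c a b z₁ - PP c a b z₂).2‖ := by
    have := mul_le_mul_of_nonneg_left D2 (inv_nonneg.mpr hs2.le)
    refine le_trans (le_of_eq ?_) this
    rw [hYV]
    field_simp
    ring
  rw [hYV] at D1
  have p3 : σ ^ 3 ≤ σ ^ 2 := pow_le_pow_of_le_one hs0.le hs1.le (by norm_num)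
  have p4 : σ ^ 4 ≤ σ ^ 2 := pow_le_pow_of_le_one hs0.le hs1.le (by norm_num)
  have p5 : σ ^ 5 ≤ σ ^ 2 := pow_le_pow_of_le_one hs0.le hs1.le (by norm_num)
  have p6 : σ ^ 6 ≤ σ ^ 2 := pow_le_pow_of_le_one hs0.le hs1.le (by norm_num)
  have q1 := mul_le_mul_of_nonneg_right p3 (mul_nonneg hA₁.le hX0)
  have q2 := mul_le_mul_of_nonneg_right p5 (mul_nonneg hA₁.le hV0)
  have q3 := mul_le_mul_of_nonneg_right p4 (mul_nonneg hA₂.le hV0)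
  have q4 := mul_le_mul_of_nonneg_right p4 (mul_nonneg hA₂.le hX0)
  have q5 := mul_le_mul_of_nonneg_right p6 (mul_nonneg hA₂.le hV0)
  have z1 : 0 ≤ σ ^ 2 * (A₁ * X) := by positivity
  have z2 : 0 ≤ σ ^ 2 * (A₁ * V) := by positivity
  have z3 : 0 ≤ σ ^ 2 * (A₂ * X) := by positivity
  have z4 : 0 ≤ σ ^ 2 * (A₂ * V) := by positivity
  have z5 : 0 ≤ σ ^ 2 * X := by positivity
  have z6 : 0 ≤ σ ^ 2 * V := by positivity
  have z7 : 0 ≤ σ ^ 2 * (C0 * V) := by positivity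
  linarith
theorem PP_analytic {a b : ℂ × ℂ → ℂ} (ha : AnalyticAt ℂ a 0) (hb : AnalyticAt ℂ b 0) (c : ℂ) :
    AnalyticAt ℂ (PP c a b) 0 := by
  have h1 : AnalyticAt ℂ (fun z : ℂ × ℂ => z.1) 0 := analyticAt_fst
  have h2 : AnalyticAt ℂ (fun z : ℂ × ℂ => z.2) 0 := analyticAt_snd
  exact (((h1.add (analyticAt_const.mul h2)).add (h1.pow 2)).add ((h1.pow 3).mul ha)).prod
    ((h2.sub (h2.pow 2)).add ((h2.pow 3).mul hb))

def LL (c : ℂ) : (ℂ × ℂ) ≃L[ℂ] (ℂ × ℂ) :=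
  ContinuousLinearEquiv.equivOfInverse
    ((ContinuousLinearMap.fst ℂ ℂ ℂ + c • ContinuousLinearMap.snd ℂ ℂ ℂ).prod
      (ContinuousLinearMap.snd ℂ ℂ ℂ))
    ((ContinuousLinearMap.fst ℂ ℂ ℂ - c • ContinuousLinearMap.snd ℂ ℂ ℂ).prod
      (ContinuousLinearMap.snd ℂ ℂ ℂ))
    (fun z => by ext <;> simp) (fun z => by ext <;> simp)

theorem PP_deriv {a b : ℂ × ℂ → ℂ} (ha : AnalyticAt ℂ a 0) (hb : AnalyticAt ℂ b 0) (c : ℂ) :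
    HasFDerivAt (PP c a b) (LL c : (ℂ × ℂ) →L[ℂ] (ℂ × ℂ)) 0 := by
  have h1 : HasFDerivAt (fun z : ℂ × ℂ => z.1) (ContinuousLinearMap.fst ℂ ℂ ℂ) 0 := hasFDerivAt_fst
  have h2 : HasFDerivAt (fun z : ℂ × ℂ => z.2) (ContinuousLinearMap.snd ℂ ℂ ℂ) 0 := hasFDerivAt_snd
  have ha' := ha.differentiableAt.hasFDerivAt
  have hb' := hb.differentiableAt.hasFDerivAt
  have h := (((h1.add (h2.const_mul c)).add (h1.pow 2)).add ((h1.pow 3).mul ha')).prodMk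
    ((h2.sub (h2.pow 2)).add ((h2.pow 3).mul hb'))
  refine HasFDerivAt.congr_fderiv h ?_
  ext <;> simp [LL]

theorem inv_exists {a b : ℂ × ℂ → ℂ} (ha : AnalyticAt ℂ a 0) (hb : AnalyticAt ℂ b 0) (c : ℂ) :
    ∃ Q : ℂ × ℂ → ℂ × ℂ, ∃ L > 0, ∃ δ > 0, (∀ z, ‖z‖ < δ → Q (PP c a b z) = z) ∧
      (∀ z, ‖z‖ < δ → PP c a b (Q z) = z) ∧ (∀ z, ‖z‖ < δ → DifferentiableAt ℂ Q z) ∧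
      (∀ z₁ z₂, ‖z₁‖ < δ → ‖z₂‖ < δ → ‖Q z₁ - Q z₂‖ ≤ L * ‖z₁ - z₂‖) := by
  have hC : ContDiffAt ℂ 1 (PP c a b) 0 := (PP_analytic ha hb c).contDiffAt
  have hd := PP_deriv ha hb c
  have hP0 : PP c a b 0 = 0 := by simp [PP]
  have hs : HasStrictFDerivAt (PP c a b) (LL c : (ℂ × ℂ) →L[ℂ] (ℂ × ℂ)) 0 :=
    hC.hasStrictFDerivAt' hd (by norm_num)
  set Q := hs.localInverse with hQ
  have e1 : ∀ᶠ z in 𝓝 (0 : ℂ × ℂ), Q (PP c a b z) = z := hs.eventually_left_inverse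
  have e2 : ∀ᶠ z in 𝓝 (0 : ℂ × ℂ), PP c a b (Q z) = z := by
    have := hs.eventually_right_inverse
    rwa [hP0] at this
  have e3 : ContDiffAt ℂ 1 Q 0 := by
    have := hC.to_localInverse hd (by norm_num)
    rw [hP0] at this
    exact this
  have e4 : ∀ᶠ z in 𝓝 (0 : ℂ × ℂ), DifferentiableAt ℂ Q z := by
    filter_upwards [e3.eventually (by simp)] with z hz
    exact hz.differentiableAt (by norm_num)
  obtain ⟨K, S, hS, hK⟩ := (e3.hasStrictFDerivAt (by norm_num)).exists_lipschitzOnWith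
  obtain ⟨δ, hδ, H⟩ := Metric.eventually_nhds_iff.mp
    (((e1.and e2).and e4).and (eventually_mem_set.mpr hS))
  simp only [dist_zero_right] at H
  refine ⟨Q, K + 1, by positivity, δ, hδ, fun z hz => (H hz).1.1.1, fun z hz => (H hz).1.1.2,
    fun z hz => (H hz).1.2, fun z₁ z₂ h1 h2 => ?_⟩
  have := hK.dist_le_mul _ (H h1).2 _ (H h2).2
  rw [dist_eq_norm, dist_eq_norm] at this
  refine this.trans ?_
  gcongr
  linarith
theorem small_ev (M : ℝ) : ∀ᶠ σ in 𝓝 (0 : ℝ), M * σ < 1 := by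
  have : Continuous fun σ : ℝ => M * σ := by fun_prop
  have h := this.tendsto 0
  rw [mul_zero] at h
  exact h.eventually_lt_const one_pos

theorem numer {n : ℕ} {D σ u v : ℝ} (hn : 8 * D ≤ n) (hD : 0 ≤ D) (hDσ : 2 * D * σ ^ 2 ≤ 1)
    (hu : 0 ≤ u) (huv : u * (1 + σ ^ 2 / 4) ≤ v) : u ^ n ≤ (1 - D * σ ^ 2) * v ^ n := by
  have hs : 0 ≤ σ ^ 2 := sq_nonneg _
  have h1 : 1 + (n : ℝ) * (σ ^ 2 / 4) ≤ (1 + σ ^ 2 / 4) ^ n :=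
    one_add_mul_le_pow (by linarith) n
  have h2 : 1 + 2 * (D * σ ^ 2) ≤ (1 + σ ^ 2 / 4) ^ n := by
    refine le_trans ?_ h1
    nlinarith
  have h3 : u ^ n * (1 + σ ^ 2 / 4) ^ n ≤ v ^ n := by
    rw [← mul_pow]; exact pow_le_pow_left₀ (by positivity) huv n
  have h4 : 0 ≤ D * σ ^ 2 := by positivity
  have h5 : 0 ≤ 1 - D * σ ^ 2 := by linarith
  have h6 : 1 ≤ (1 - D * σ ^ 2) * (1 + σ ^ 2 / 4) ^ n := by
    calc (1:ℝ) ≤ (1 - D * σ ^ 2) * (1 + 2 * (D * σ ^ 2)) := by nlinarith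
      _ ≤ _ := by gcongr
  calc u ^ n = u ^ n * 1 := by ring
    _ ≤ u ^ n * ((1 - D * σ ^ 2) * (1 + σ ^ 2 / 4) ^ n) := by gcongr
    _ = (1 - D * σ ^ 2) * (u ^ n * (1 + σ ^ 2 / 4) ^ n) := by ring
    _ ≤ _ := by gcongr

theorem NN_mono {w w' : ℂ} (h : ‖w‖ ≤ ‖w'‖) (d : ℂ × ℂ) : NN w d ≤ NN w' d := by
  unfold NN; gcongr

theorem NN_tri (w : ℂ) (x y z : ℂ × ℂ) : NN w (x - z) ≤ NN w (x - y) + NN w (y - z) := by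
  unfold NN
  have h1 : ‖(x - z).1‖ ≤ ‖(x - y).1‖ + ‖(y - z).1‖ := by
    simp only [Prod.fst_sub]; exact norm_sub_le_norm_sub_add_norm_sub _ _ _
  have h2 : ‖(x - z).2‖ ≤ ‖(x - y).2‖ + ‖(y - z).2‖ := by
    simp only [Prod.snd_sub]; exact norm_sub_le_norm_sub_add_norm_sub _ _ _
  have h3 : 0 ≤ ‖w‖ ^ 2 := by positivity
  nlinarith

theorem kk_sq (b : ℂ × ℂ → ℂ) (p : ℂ → ℂ) (s : ℂ) :
    (kk b p s) ^ 2 = 1 + (- s ^ 2 + s ^ 4 * b (p s, s ^ 2)) := by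
  unfold kk
  have := Complex.cpow_nat_inv_pow (1 + (- s ^ 2 + s ^ 4 * b (p s, s ^ 2))) (n := 2) (by norm_num)
  simpa using this

def strip (R η : ℝ) : Set ℂ := {w | R < w.re ∧ |w.im| < η}

theorem strip_open (R η : ℝ) : IsOpen (strip R η) := by
  unfold strip
  refine IsOpen.inter (isOpen_lt continuous_const Complex.continuous_re)
    (isOpen_lt (continuous_abs.comp Complex.continuous_im) continuous_const)

set_option maxHeartbeats 1000000 in
theorem curve_exists {a b : ℂ × ℂ → ℂ} (ha : AnalyticAt ℂ a 0) (hb : AnalyticAt ℂ b 0)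
    (δP : ℝ) (hδP : 0 < δP) :
    ∃ R : ℝ, 2 ≤ R ∧ ∃ (G : ℂ → ℂ) (φ : ℂ → ℂ × ℂ), DifferentiableOn ℂ φ (strip R 1) ∧
      ∀ w ∈ strip R 1, w.re < (G w).re ∧
        (∀ η : ℝ, 1 / 2 ≤ η → |w.im| < η → |(G w).im| < η) ∧
        ‖w‖ ^ 2 + 1 / 2 ≤ ‖G w‖ ^ 2 ∧ ‖φ w‖ ≤ 4 * ‖w‖⁻¹ ∧ ‖φ w‖ < δP ∧
        ‖(φ w).2 - w⁻¹ ^ 2‖ ≤ ‖w‖⁻¹ ^ 6 ∧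
        PP ((Real.pi : ℂ) ^ 2 / 4) a b (φ w) = φ (G w) := by
  set c : ℂ := (Real.pi : ℂ) ^ 2 / 4 with hc
  set c1 : ℂ := Complex.I * ((Real.pi / 2 : ℝ) : ℂ) with hc1
  have hpi := Real.pi_pos
  have hpi4 := Real.pi_le_four
  have hcn : ‖c‖ ≤ 4 := by
    rw [hc]; simp only [norm_div, norm_pow, Complex.norm_real, Real.norm_eq_abs, abs_of_pos hpi]
    norm_num
    nlinarith
  have hc1n : ‖c1‖ ≤ 2 := by
    rw [hc1, norm_mul, Complex.norm_I, Complex.norm_real, Real.norm_eq_abs, abs_of_pos (by positivity)]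
    linarith
  have hc10 : c1 ≠ 0 := by
    rw [hc1]
    refine mul_ne_zero Complex.I_ne_zero ?_
    exact_mod_cast (by positivity : Real.pi / 2 ≠ 0)
  have hcc : c1 ^ 2 = - c := by
    rw [hc, hc1, mul_pow, Complex.I_sq]; push_cast; ring
  obtain ⟨c2, hser⟩ := ser_exists c c1 hc10 hcc ha hb
  obtain ⟨C, hC, δe, hδe, hexp⟩ := expand ha hb c c1 hcn hc1n (‖c2‖ + 2) (by positivity)
  obtain ⟨m, hm⟩ := exists_nat_ge (8 * (C + 1) + 4)
  have hm4 : 4 ≤ m := by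
    have : (4:ℝ) ≤ m := by linarith
    exact_mod_cast this
  obtain ⟨p, hp, hp0, hpO, hEO⟩ := hser (m + 4)
  obtain ⟨Q, L, hL, δi, hδi, hQP, hPQ, hQd, hQL⟩ := inv_exists ha hb c
  obtain ⟨R0, hR0⟩ := orb (kk_inv_bigO hb hp hp0)
  obtain ⟨Cp, hCp, hpO'⟩ := hpO.exists_pos
  obtain ⟨CE, hCE, hEO'⟩ := hEO.exists_pos
  rw [isBigOWith_iff] at hpO' hEO'
  have hka := kk_analytic hb hp hp0
  have hkne : ∀ᶠ s in 𝓝 0, kk b p s ≠ 0 := hka.continuousAt.eventually_ne (by simp [kk])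
  obtain ⟨δs, hδs, Hs⟩ := Metric.eventually_nhds_iff.mp
    ((((hpO'.and hEO').and hp.eventually_analyticAt).and hka.eventually_analyticAt).and hkne)
  obtain ⟨σ0, hσ0, Hσ⟩ := Metric.eventually_nhds_iff.mp
    ((small_ev CE).and <| (small_ev (2 * L)).and <| (small_ev (‖c2‖ + 1)).and <|
      (small_ev (4 / δi)).and <| (small_ev (4 / δP)).and <| (small_ev Cp).and <|
      (small_ev (2 * (C + 1))).and (small_ev (1 / δe)))
  set R : ℝ := max R0 (max 2 (max σ0⁻¹ δs⁻¹)) with hR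
  have hRR0 : R0 ≤ R := le_max_left _ _
  have hR2 : 2 ≤ R := (le_max_left _ _).trans (le_max_right _ _)
  have hRσ : σ0⁻¹ ≤ R :=
    (le_max_left _ _).trans ((le_max_right _ _).trans (le_max_right _ _))
  have hRδ : δs⁻¹ ≤ R :=
    (le_max_right _ _).trans ((le_max_right _ _).trans (le_max_right _ _))
  set G : ℂ → ℂ := fun w => w * (kk b p w⁻¹)⁻¹ with hG
  set φ0 : ℂ → ℂ × ℂ := fun w => (p w⁻¹, w⁻¹ ^ 2) with hφ0
  have hnorm : ∀ w ∈ strip R 1, R < ‖w‖ := fun w hw => hw.1.trans_le (Complex.re_le_norm w)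
  have horb : ∀ w ∈ strip R 1, w.re < (G w).re ∧
      (∀ η : ℝ, 1 / 2 ≤ η → |w.im| < η → |(G w).im| < η) ∧
      ‖w‖ * (1 + ‖w‖⁻¹ ^ 2 / 4) ≤ ‖G w‖ := fun w hw =>
    hR0 w (hRR0.trans_lt hw.1) hw.2.le
  have hGW : Set.MapsTo G (strip R 1) (strip R 1) := fun w hw =>
    ⟨hw.1.trans (horb w hw).1, (horb w hw).2.1 1 (by norm_num) hw.2⟩
  -- all the smallness facts
  have hsm : ∀ w ∈ strip R 1, 0 < ‖w‖⁻¹ ∧ ‖w‖⁻¹ < 1 ∧ CE * ‖w‖⁻¹ < 1 ∧ 2 * L * ‖w‖⁻¹ < 1 ∧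
      (‖c2‖ + 1) * ‖w‖⁻¹ < 1 ∧ 4 * ‖w‖⁻¹ < δi ∧ 4 * ‖w‖⁻¹ < δP ∧ Cp * ‖w‖⁻¹ < 1 ∧
      2 * (C + 1) * ‖w‖⁻¹ < 1 ∧ ‖w‖⁻¹ < δe := by
    intro w hw
    have h1 := hnorm w hw
    have h0 : 0 < ‖w‖⁻¹ := inv_pos.mpr (by linarith)
    have hlt : ‖w‖⁻¹ < σ0 := inv_lt_of_inv_lt₀ hσ0 (by linarith)
    obtain ⟨k1, k2, k3, k4, k5, k6, k7, k8⟩ := Hσ (y := ‖w‖⁻¹) (by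
      rw [dist_zero_right, Real.norm_eq_abs, abs_of_pos h0]; exact hlt)
    refine ⟨h0, inv_lt_one_of_one_lt₀ (by linarith), k1, k2, k3, ?_, ?_, k6, k7, ?_⟩
    · rw [div_mul_eq_mul_div, div_lt_one hδi] at k4; exact k4
    · rw [div_mul_eq_mul_div, div_lt_one hδP] at k5; exact k5
    · rw [div_mul_eq_mul_div, div_lt_one hδe, one_mul] at k8; exact k8
  have hloc : ∀ w ∈ strip R 1, ((‖p w⁻¹ - c1 * w⁻¹ - c2 * w⁻¹ ^ 2‖ ≤ Cp * ‖w⁻¹ ^ 3‖ ∧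
      ‖EE c a b p w⁻¹‖ ≤ CE * ‖w⁻¹ ^ (m + 4)‖) ∧ AnalyticAt ℂ p w⁻¹) ∧
      AnalyticAt ℂ (kk b p) w⁻¹ ∧ kk b p w⁻¹ ≠ 0 := by
    intro w hw
    have h1 := hnorm w hw
    obtain ⟨⟨h, h3⟩, h4⟩ := Hs (y := w⁻¹) (by
      rw [dist_zero_right, norm_inv]; exact inv_lt_of_inv_lt₀ hδs (by linarith))
    exact ⟨h, h3, h4⟩
  have hreg : ∀ w ∈ strip R 1, ‖p w⁻¹ - c1 * w⁻¹‖ ≤ (‖c2‖ + 1) * ‖w‖⁻¹ ^ 2 := by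
    intro w hw
    obtain ⟨h0, h1, k1, k2, k3, k4, k5, k6, k7, k8⟩ := hsm w hw
    have h := (hloc w hw).1.1.1
    have e : p w⁻¹ - c1 * w⁻¹ = (p w⁻¹ - c1 * w⁻¹ - c2 * w⁻¹ ^ 2) + c2 * w⁻¹ ^ 2 := by ring
    rw [e]
    refine (norm_add_le _ _).trans ?_
    rw [norm_mul, norm_pow, norm_inv]
    rw [norm_pow, norm_inv] at h
    have : Cp * ‖w‖⁻¹ ^ 3 ≤ ‖w‖⁻¹ ^ 2 := by
      have : Cp * ‖w‖⁻¹ ^ 3 = (Cp * ‖w‖⁻¹) * ‖w‖⁻¹ ^ 2 := by ring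
      rw [this]
      exact mul_le_of_le_one_left (by positivity) k6.le
    linarith
  have hφ0n : ∀ w ∈ strip R 1, ‖φ0 w‖ ≤ 3 * ‖w‖⁻¹ := by
    intro w hw
    obtain ⟨h0, h1, k1, k2, k3, k4, k5, k6, k7, k8⟩ := hsm w hw
    have h := hreg w hw
    rw [hφ0, Prod.norm_def]
    apply max_le
    · have e1 : ‖p w⁻¹‖ ≤ ‖p w⁻¹ - c1 * w⁻¹‖ + ‖c1 * w⁻¹‖ := by
        have := norm_add_le (p w⁻¹ - c1 * w⁻¹) (c1 * w⁻¹)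
        rwa [sub_add_cancel] at this
      rw [norm_mul, norm_inv] at e1
      show ‖p w⁻¹‖ ≤ _
      nlinarith
    · show ‖w⁻¹ ^ 2‖ ≤ _
      rw [norm_pow, norm_inv]
      nlinarith
  have hw1 : ∀ w ∈ strip R 1, 1 ≤ ‖w‖ := fun w hw => by linarith [hnorm w hw]
  have hle : ∀ w ∈ strip R 1, ‖w‖ ≤ ‖G w‖ := by
    intro w hw
    refine le_trans ?_ (horb w hw).2.2
    have : 0 ≤ ‖w‖ * (‖w‖⁻¹ ^ 2 / 4) := by positivity
    linarith
  have hle' : ∀ w ∈ strip R 1, ‖G w‖⁻¹ ≤ ‖w‖⁻¹ := fun w hw =>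
    inv_anti₀ (by linarith [hw1 w hw]) (hle w hw)
  have hgr : ∀ w ∈ strip R 1, ‖w‖ ^ 2 + 1 / 2 ≤ ‖G w‖ ^ 2 := by
    intro w hw
    have h := (horb w hw).2.2
    have h1 := hw1 w hw
    have e : ‖w‖ * ‖w‖⁻¹ = 1 := mul_inv_cancel₀ (by linarith)
    calc ‖w‖ ^ 2 + 1 / 2 = ‖w‖ ^ 2 + (‖w‖ * ‖w‖⁻¹) ^ 2 / 2 := by rw [e]; norm_num
      _ ≤ (‖w‖ * (1 + ‖w‖⁻¹ ^ 2 / 4)) ^ 2 := by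
        have : 0 ≤ (‖w‖ * (‖w‖⁻¹ ^ 2 / 4)) ^ 2 := by positivity
        nlinarith
      _ ≤ ‖G w‖ ^ 2 := by gcongr
  have hres : ∀ w ∈ strip R 1, PP c a b (φ0 w) - φ0 (G w) = (EE c a b p w⁻¹, 0) := by
    intro w hw
    have hGi : (G w)⁻¹ = w⁻¹ * kk b p w⁻¹ := by simp [hG, mul_comm]
    have hk := kk_sq b p w⁻¹
    simp only [PP, hφ0, EE, hGi]
    ext
    · simp only [Prod.fst_sub]
    · simp only [Prod.snd_sub]
      rw [mul_pow, hk]; ring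
  have hresn : ∀ w ∈ strip R 1, NN (G w) (PP c a b (φ0 w) - φ0 (G w)) ≤
      ‖w‖⁻¹ ^ 2 * ‖w‖⁻¹ ^ (m + 1) := by
    intro w hw
    obtain ⟨h0, h1, k1, k2, k3, k4, k5, k6, k7, k8⟩ := hsm w hw
    rw [hres w hw]
    have h := (hloc w hw).1.1.2
    rw [norm_pow, norm_inv] at h
    have e : CE * ‖w‖⁻¹ ^ (m + 4) = (CE * ‖w‖⁻¹) * (‖w‖⁻¹ ^ 2 * ‖w‖⁻¹ ^ (m + 1)) := by ring
    rw [e] at h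
    simp only [NN, norm_zero, mul_zero, add_zero]
    exact h.trans (mul_le_of_le_one_left (by positivity) k1.le)
  have hBn : ∀ w ∈ strip R 1, ∀ z, NN w (z - φ0 w) ≤ (‖w‖ ^ (m + 1))⁻¹ → ‖z‖ ≤ 4 * ‖w‖⁻¹ := by
    intro w hw z hz
    obtain ⟨h0, h1, k1, k2, k3, k4, k5, k6, k7, k8⟩ := hsm w hw
    have e1 := (norm_le_NN (hw1 w hw) _).trans hz
    have e2 := hφ0n w hw
    have e3 : ‖z‖ ≤ ‖z - φ0 w‖ + ‖φ0 w‖ := by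
      have := norm_add_le (z - φ0 w) (φ0 w)
      rwa [sub_add_cancel] at this
    have e4 : (‖w‖ ^ (m + 1))⁻¹ ≤ ‖w‖⁻¹ := by
      rw [← inv_pow]
      exact pow_le_of_le_one h0.le h1.le (by omega)
    linarith
  have hstep : ∀ w ∈ strip R 1, ∀ z, NN (G w) (z - φ0 (G w)) ≤ (‖G w‖ ^ (m + 1))⁻¹ →
      PP c a b (Q z) = z ∧ ‖(Q z).1 - c1 * w⁻¹‖ ≤ (‖c2‖ + 2) * ‖w⁻¹‖ ^ 2 ∧
      ‖(Q z).2 - w⁻¹ ^ 2‖ ≤ ‖w⁻¹‖ ^ 2 := by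
    intro w hw z hz
    obtain ⟨h0, h1, k1, k2, k3, k4, k5, k6, k7, k8⟩ := hsm w hw
    have hw' := hGW hw
    have hl := hle' w hw
    have zn := hBn _ hw' z hz
    have e1 : ‖z - φ0 (G w)‖ ≤ ‖w‖⁻¹ ^ (m + 1) := by
      refine (norm_le_NN (hw1 _ hw') _).trans (hz.trans ?_)
      rw [← inv_pow]; gcongr
    have e2 : ‖PP c a b (φ0 w) - φ0 (G w)‖ ≤ ‖w‖⁻¹ ^ (m + 1) := by
      refine (norm_le_NN (hw1 _ hw') _).trans ((hresn w hw).trans ?_)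
      exact mul_le_of_le_one_left (by positivity) (pow_le_one₀ h0.le h1.le)
    have hpm : ‖w‖⁻¹ ^ (m + 1) ≤ ‖w‖⁻¹ ^ 3 := pow_le_pow_of_le_one h0.le h1.le (by omega)
    have hp31 : ‖w‖⁻¹ ^ 3 ≤ ‖w‖⁻¹ := pow_le_of_le_one h0.le h1.le (by norm_num)
    have hφn := hφ0n w hw
    have hPn : ‖PP c a b (φ0 w)‖ < δi := by
      have e3 : ‖PP c a b (φ0 w)‖ ≤ ‖PP c a b (φ0 w) - φ0 (G w)‖ + ‖φ0 (G w)‖ := by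
        have := norm_add_le (PP c a b (φ0 w) - φ0 (G w)) (φ0 (G w))
        rwa [sub_add_cancel] at this
      have := hφ0n _ hw'
      linarith
    have hzn : ‖z‖ < δi := by linarith
    have e5 := hQL z (PP c a b (φ0 w)) hzn hPn
    rw [hQP _ (by linarith)] at e5
    have e6 : ‖z - PP c a b (φ0 w)‖ ≤ 2 * ‖w‖⁻¹ ^ 3 := by
      have := norm_sub_le_norm_sub_add_norm_sub z (φ0 (G w)) (PP c a b (φ0 w))
      rw [norm_sub_rev (φ0 (G w))] at this
      linarith
    have e7 : ‖Q z - φ0 w‖ ≤ ‖w‖⁻¹ ^ 2 := by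
      refine e5.trans ?_
      calc L * ‖z - PP c a b (φ0 w)‖ ≤ L * (2 * ‖w‖⁻¹ ^ 3) := by gcongr
        _ = (2 * L * ‖w‖⁻¹) * ‖w‖⁻¹ ^ 2 := by ring
        _ ≤ ‖w‖⁻¹ ^ 2 := mul_le_of_le_one_left (by positivity) k2.le
    refine ⟨hPQ z hzn, ?_, ?_⟩
    · have t1 := (norm_fst_le (Q z - φ0 w)).trans e7
      have t2 : ‖(Q z).1 - p w⁻¹‖ ≤ ‖w‖⁻¹ ^ 2 := t1
      have t3 := norm_sub_le_norm_sub_add_norm_sub (Q z).1 (p w⁻¹) (c1 * w⁻¹)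
      have t4 := hreg w hw
      rw [norm_inv]
      linarith
    · have t1 := (norm_snd_le (Q z - φ0 w)).trans e7
      rw [norm_inv]
      exact t1
  have him : ∀ w ∈ strip R 1, |(c1 * w⁻¹).re| ≤ 2 * ‖w⁻¹‖ ^ 2 := by
    intro w hw
    have hne : ‖w‖ ≠ 0 := by linarith [hw1 w hw]
    have e1 : (c1 * w⁻¹).re = Real.pi / 2 * w.im * ‖w‖⁻¹ ^ 2 := by
      rw [hc1, mul_assoc, Complex.I_mul_re, Complex.re_ofReal_mul |> fun _ => Complex.im_ofReal_mul _ _,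
        Complex.inv_im, Complex.normSq_eq_norm_sq]
      field_simp
    rw [e1, norm_inv, abs_mul, abs_mul, abs_of_pos (by positivity : 0 < Real.pi / 2),
      abs_of_nonneg (by positivity : 0 ≤ ‖w‖⁻¹ ^ 2)]
    have h2 := hw.2
    have h3 := abs_nonneg w.im
    have : Real.pi / 2 * |w.im| ≤ 2 := by nlinarith
    gcongr
  have hexpw : ∀ w ∈ strip R 1, ∀ z₁ z₂ : ℂ × ℂ,
      ‖z₁.1 - c1 * w⁻¹‖ ≤ (‖c2‖ + 2) * ‖w⁻¹‖ ^ 2 → ‖z₁.2 - w⁻¹ ^ 2‖ ≤ ‖w⁻¹‖ ^ 2 →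
      ‖z₂.1 - c1 * w⁻¹‖ ≤ (‖c2‖ + 2) * ‖w⁻¹‖ ^ 2 → ‖z₂.2 - w⁻¹ ^ 2‖ ≤ ‖w⁻¹‖ ^ 2 →
      (1 - C * ‖w‖⁻¹ ^ 2) * NN w (z₁ - z₂) ≤ NN (G w) (PP c a b z₁ - PP c a b z₂) := by
    intro w hw z₁ z₂ h1 h2 h3 h4
    obtain ⟨h0, _, k1, k2, k3, k4, k5, k6, k7, k8⟩ := hsm w hw
    have := hexp w⁻¹ (by rw [norm_inv]; exact h0) (by rw [norm_inv]; exact k8) (him w hw)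
      z₁ z₂ h1 h2 h3 h4
    rw [inv_inv, norm_inv] at this
    exact this.trans (NN_mono (hle w hw) _)
  have hDσ : ∀ w ∈ strip R 1, 2 * (C + 1) * ‖w‖⁻¹ ^ 2 ≤ 1 := by
    intro w hw
    obtain ⟨h0, h1, k1, k2, k3, k4, k5, k6, k7, k8⟩ := hsm w hw
    have : ‖w‖⁻¹ ^ 2 ≤ ‖w‖⁻¹ := pow_le_of_le_one h0.le h1.le (by norm_num)
    nlinarith
  have hcore : ∃ φ : ℂ → ℂ × ℂ, DifferentiableOn ℂ φ (strip R 1) ∧ ∀ w ∈ strip R 1,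
      NN w (φ w - φ0 w) ≤ (‖w‖ ^ (m + 1))⁻¹ ∧ Q (φ (G w)) = φ w := by
    refine core m (strip R 1) (strip_open _ _) G Q φ0 hGW hw1 hgr ?_ ?_ ?_ ?_ ?_
    · -- invariance
      intro w hw z hz
      obtain ⟨s1, s2, s3⟩ := hstep w hw z hz
      obtain ⟨h0, h1, k1, k2, k3, k4, k5, k6, k7, k8⟩ := hsm w hw
      have hp1 : 0 ≤ ‖w⁻¹‖ ^ 2 := by positivity
      have e := hexpw w hw (Q z) (φ0 w) s2 s3
        (by
          have := hreg w hw
          rw [norm_inv] at hp1 ⊢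
          show ‖p w⁻¹ - c1 * w⁻¹‖ ≤ _
          linarith)
        (by simp only [hφ0, sub_self, norm_zero]; exact hp1)
      rw [s1] at e
      have t := NN_tri (G w) z (φ0 (G w)) (PP c a b (φ0 w))
      rw [NN_sub_comm _ (φ0 (G w))] at t
      have r := hresn w hw
      have nm := numer (n := m + 1) (D := C + 1) (σ := ‖w‖⁻¹) (by push_cast; linarith) (by positivity)
        (hDσ w hw) (norm_nonneg w) (horb w hw).2.2
      have hwp : 0 < ‖w‖ ^ (m + 1) := pow_pos (by linarith [hw1 w hw]) _
      have hwp' : 0 < ‖G w‖ ^ (m + 1) := pow_pos (by linarith [hw1 w hw, hle w hw]) _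
      have nm' : (‖G w‖ ^ (m + 1))⁻¹ ≤ (1 - (C + 1) * ‖w‖⁻¹ ^ 2) * (‖w‖ ^ (m + 1))⁻¹ := by
        rw [inv_eq_one_div, ← div_eq_mul_inv, div_le_div_iff₀ hwp' hwp]
        linarith
      rw [inv_pow ‖w‖ (m + 1)] at r
      have fin : (1 - C * ‖w‖⁻¹ ^ 2) * NN w (Q z - φ0 w) ≤
          (1 - C * ‖w‖⁻¹ ^ 2) * (‖w‖ ^ (m + 1))⁻¹ := by linarith
      refine le_of_mul_le_mul_left fin ?_
      have := hDσ w hw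
      nlinarith
    · intro w hw z₁ z₂ hz₁ hz₂
      obtain ⟨s1, s2, s3⟩ := hstep w hw z₁ hz₁
      obtain ⟨t1, t2, t3⟩ := hstep w hw z₂ hz₂
      have e := hexpw w hw (Q z₁) (Q z₂) s2 s3 t2 t3
      rw [s1, t1] at e
      have hD := hDσ w hw
      have hp1 : 0 ≤ ‖w‖⁻¹ ^ 2 := by positivity
      have nm := numer (n := m) (D := C) (σ := ‖w‖⁻¹) (by linarith) (by positivity)
        (by nlinarith) (norm_nonneg w) (horb w hw).2.2
      calc ‖w‖ ^ m * NN w (Q z₁ - Q z₂) ≤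
          ((1 - C * ‖w‖⁻¹ ^ 2) * ‖G w‖ ^ m) * NN w (Q z₁ - Q z₂) :=
            mul_le_mul_of_nonneg_right nm (NN_nonneg _ _)
        _ = ‖G w‖ ^ m * ((1 - C * ‖w‖⁻¹ ^ 2) * NN w (Q z₁ - Q z₂)) := by ring
        _ ≤ _ := by gcongr
    · intro w hw
      have hne : w ≠ 0 := norm_pos_iff.mp (by linarith [hw1 w hw])
      have hi : DifferentiableAt ℂ (fun w : ℂ => w⁻¹) w := differentiableAt_inv hne
      have h1 : DifferentiableAt ℂ (fun w : ℂ => p w⁻¹) w :=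
        DifferentiableAt.comp (g := p) w (hloc w hw).1.2.differentiableAt hi
      exact (h1.prodMk (hi.pow 2)).differentiableWithinAt
    · intro w hw
      have hne : w ≠ 0 := norm_pos_iff.mp (by linarith [hw1 w hw])
      have hi : DifferentiableAt ℂ (fun w : ℂ => w⁻¹) w := differentiableAt_inv hne
      have h1 : DifferentiableAt ℂ (fun w : ℂ => kk b p w⁻¹) w :=
        DifferentiableAt.comp (g := kk b p) w (hloc w hw).2.1.differentiableAt hi
      exact (differentiableAt_id.mul (h1.inv (hloc w hw).2.2)).differentiableWithinAt
    · intro w hw z hz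
      obtain ⟨h0, h1, k1, k2, k3, k4, k5, k6, k7, k8⟩ := hsm w hw
      exact hQd z (by linarith [hBn w hw z hz])
  obtain ⟨φ, hφd, hφ⟩ := hcore
  refine ⟨R, hR2, G, φ, hφd, fun w hw => ?_⟩
  have hB := (hφ w hw).1
  have hn := hBn w hw _ hB
  obtain ⟨h0, h1, k1, k2, k3, k4, k5, k6, k7, k8⟩ := hsm w hw
  refine ⟨(horb w hw).1, (horb w hw).2.1, hgr w hw, hn, by linarith, ?_, ?_⟩
  · have h2 : ‖w‖ ^ 2 * ‖(φ w).2 - w⁻¹ ^ 2‖ ≤ ‖w‖⁻¹ ^ (m + 1) := by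
      rw [inv_pow ‖w‖ (m + 1)]
      refine le_trans ?_ hB
      unfold NN
      exact le_add_of_nonneg_left (norm_nonneg _)
    have h3 : ‖w‖⁻¹ ^ (m + 1) ≤ ‖w‖⁻¹ ^ 4 := pow_le_pow_of_le_one h0.le h1.le (by omega)
    have hne : ‖w‖ ≠ 0 := by linarith [hw1 w hw]
    calc ‖(φ w).2 - w⁻¹ ^ 2‖ = ‖w‖⁻¹ ^ 2 * (‖w‖ ^ 2 * ‖(φ w).2 - w⁻¹ ^ 2‖) := by
          field_simp
      _ ≤ ‖w‖⁻¹ ^ 2 * ‖w‖⁻¹ ^ 4 := by gcongr; exact h2.trans h3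
      _ = ‖w‖⁻¹ ^ 6 := by ring
  · have := (hstep w hw _ (hφ _ (hGW hw)).1).1
    rw [(hφ w hw).2] at this
    exact this

theorem strip_convex (R η : ℝ) : Convex ℝ (strip R η) := by
  intro x hx y hy s t hs ht hst
  obtain ⟨hx1, hx2⟩ := hx
  obtain ⟨hy1, hy2⟩ := hy
  rw [abs_lt] at hx2 hy2
  refine ⟨?_, ?_⟩
  · have : (s • x + t • y).re = s * x.re + t * y.re := by simp
    rw [this]
    rcases eq_or_lt_of_le hs with h | h
    · subst h
      have : t = 1 := by linarith
      subst this
      linarith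
    · have e1 := mul_pos h (sub_pos.mpr hx1)
      have e2 := mul_nonneg ht (sub_pos.mpr hy1).le
      have e3 : (s + t) * R = R := by rw [hst, one_mul]
      linarith
  · have : (s • x + t • y).im = s * x.im + t * y.im := by simp
    rw [this, abs_lt]
    rcases eq_or_lt_of_le hs with h | h
    · subst h
      have : t = 1 := by linarith
      subst this
      constructor <;> linarith
    · constructor <;> nlinarith

theorem eps_bound {w y : ℂ} (hw : 2 ≤ ‖w‖) (hy : ‖y - w⁻¹ ^ 2‖ ≤ ‖w‖⁻¹ ^ 6) :
    y ≠ 0 ∧ ‖y⁻¹ - w ^ 2‖ ≤ 1 / 2 := by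
  have hpos : 0 < ‖w‖ := by linarith
  have hw0 : w ≠ 0 := norm_pos_iff.mp hpos
  set σ := ‖w‖⁻¹ with hσ
  have hσ0 : 0 < σ := inv_pos.mpr hpos
  have hσ1 : σ ≤ 1 / 2 := by
    rw [hσ, one_div]; exact inv_anti₀ (by norm_num) hw
  have hn : ‖w⁻¹ ^ 2‖ = σ ^ 2 := by rw [norm_pow, norm_inv]
  have hσ2 : σ ^ 2 ≤ 1 / 4 := by nlinarith
  have h6 : σ ^ 6 ≤ σ ^ 2 / 2 := by
    have : σ ^ 6 = σ ^ 2 * (σ ^ 2 * σ ^ 2) := by ring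
    have h0 : 0 ≤ σ ^ 2 := by positivity
    have : σ ^ 2 * σ ^ 2 ≤ 1 / 2 := by nlinarith
    nlinarith
  have hlow : σ ^ 2 / 2 ≤ ‖y‖ := by
    have := norm_sub_norm_le (w⁻¹ ^ 2) y
    rw [norm_sub_rev, hn] at this
    linarith
  have hyp : 0 < ‖y‖ := lt_of_lt_of_le (by positivity) hlow
  have hy0 : y ≠ 0 := norm_pos_iff.mp hyp
  refine ⟨hy0, ?_⟩
  have e : y⁻¹ - w ^ 2 = -(y - w⁻¹ ^ 2) * (y⁻¹ * w ^ 2) := by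
    field_simp
    ring
  have hww : ‖w‖ ^ 2 * σ ^ 2 = 1 := by rw [hσ]; field_simp
  rw [e, norm_mul, norm_neg, norm_mul, norm_inv, norm_pow]
  have hinv : ‖y‖⁻¹ ≤ (σ ^ 2 / 2)⁻¹ := inv_anti₀ (by positivity) hlow
  calc ‖y - w⁻¹ ^ 2‖ * (‖y‖⁻¹ * ‖w‖ ^ 2) ≤ σ ^ 6 * ((σ ^ 2 / 2)⁻¹ * ‖w‖ ^ 2) := by gcongr
    _ = 2 * σ ^ 2 * (‖w‖ ^ 2 * σ ^ 2) := by field_simp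
    _ ≤ 1 / 2 := by rw [hww]; linarith

theorem strip_inj {R : ℝ} (hR : 2 ≤ R) {f : ℂ → ℂ} (hf : DifferentiableOn ℂ f (strip R 1))
    (hb : ∀ w ∈ strip R 1, ‖f w - w⁻¹ ^ 2‖ ≤ ‖w‖⁻¹ ^ 6) :
    Set.InjOn f (strip (R + 1) (1 / 2)) := by
  have hn : ∀ w ∈ strip R 1, 2 ≤ ‖w‖ := fun w hw =>
    hR.trans (hw.1.le.trans (Complex.re_le_norm w))
  set e : ℂ → ℂ := fun w => (f w)⁻¹ - w ^ 2 with he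
  have hed : DifferentiableOn ℂ e (strip R 1) :=
    (hf.fun_inv fun w hw => (eps_bound (hn w hw) (hb w hw)).1).sub
      (differentiable_id.pow 2).differentiableOn
  have hsub : ∀ w ∈ strip (R + 1) (1 / 2), closedBall w (1 / 4) ⊆ strip R 1 := by
    intro w hw v hv
    rw [mem_closedBall, dist_eq_norm] at hv
    have h1 := (Complex.abs_re_le_norm (v - w)).trans hv
    have h2 := (Complex.abs_im_le_norm (v - w)).trans hv
    obtain ⟨w1, w2⟩ := hw
    rw [abs_le] at h1 h2
    rw [abs_lt] at w2
    simp only [Complex.sub_re, Complex.sub_im] at h1 h2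
    exact ⟨by linarith, abs_lt.mpr ⟨by linarith, by linarith⟩⟩
  have hself : ∀ w ∈ strip (R + 1) (1 / 2), w ∈ strip R 1 := fun w hw =>
    hsub w hw (mem_closedBall_self (by norm_num))
  have hder : ∀ w ∈ strip (R + 1) (1 / 2), ‖deriv e w‖ ≤ 2 := by
    intro w hw
    have := Complex.norm_deriv_le_of_forall_mem_sphere_norm_le (c := w) (R := 1 / 4) (C := 1 / 2)
      (f := e) (by norm_num)
      ((hed.mono (hsub w hw)).diffContOnCl_ball (subset_refl _))
      (fun z hz => (eps_bound (hn z (hsub w hw (sphere_subset_closedBall hz)))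
        (hb z (hsub w hw (sphere_subset_closedBall hz)))).2)
    norm_num at this
    exact this
  intro w₁ h₁ w₂ h₂ heq
  have hl := Convex.norm_image_sub_le_of_norm_deriv_le (𝕜 := ℂ) (f := e) (C := 2)
    (s := strip (R + 1) (1 / 2))
    (fun w hw => (hed w (hself w hw)).differentiableAt ((strip_open R 1).mem_nhds (hself w hw)))
    hder (strip_convex _ _) h₁ h₂
  by_contra hne
  have e1 : e w₂ - e w₁ = -((w₂ - w₁) * (w₂ + w₁)) := by
    simp only [he]
    rw [heq]; ring
  rw [e1, norm_neg, norm_mul] at hl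
  have hp : 0 < ‖w₂ - w₁‖ := norm_pos_iff.mpr (sub_ne_zero.mpr (Ne.symm hne))
  have hs := Complex.re_le_norm (w₂ + w₁)
  rw [Complex.add_re] at hs
  have := h₁.1
  have := h₂.1
  nlinarith

/-- Let `P(x,y) = (x + (π²/4)y + x² + x³a(x,y), y − y² + y³b(x,y))` near `0`, with `a`, `b`
holomorphic near `0`, and suppose `0` is an isolated fixed point of `P`. Then `P` has a
parabolic curve at `0` not contained in the invariant curve `{y = 0}`. -/
theorem astorg_map_has_parabolic_curve_off_axis (P : ℂ × ℂ → ℂ × ℂ) (a b : ℂ × ℂ → ℂ)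
    (ha : AnalyticAt ℂ a 0) (hb : AnalyticAt ℂ b 0)
    (hP : ∀ᶠ z in 𝓝 (0 : ℂ × ℂ), P z =
      (z.1 + ((Real.pi : ℂ) ^ 2 / 4) * z.2 + z.1 ^ 2 + z.1 ^ 3 * a z,
        z.2 - z.2 ^ 2 + z.2 ^ 3 * b z))
    (hiso : ∃ U ∈ 𝓝 (0 : ℂ × ℂ), ∀ z ∈ U, P z = z → z = 0) :
    ∃ Ω : Set (ℂ × ℂ), IsParabolicCurve P Ω ∧ ¬ Ω ⊆ {z : ℂ × ℂ | z.2 = 0} := by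
  obtain ⟨δP, hδ, hPP⟩ := Metric.eventually_nhds_iff.mp hP
  obtain ⟨R, hR, G, φ, hφd, hφ⟩ := curve_exists ha hb δP hδ
  have hsub : strip (R + 1) (1 / 2) ⊆ strip R 1 := by
    intro w hw
    exact ⟨by linarith [hw.1], by linarith [hw.2]⟩
  have hn : ∀ w ∈ strip R 1, 2 ≤ ‖w‖ := fun w hw =>
    hR.trans (hw.1.le.trans (Complex.re_le_norm w))
  have hstep : ∀ w ∈ strip R 1, P (φ w) = φ (G w) := by
    intro w hw
    obtain ⟨-, -, -, -, h5, -, h7⟩ := hφ w hw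
    rw [← h7]
    exact hPP (by rwa [dist_zero_right])
  have hne : ∀ w ∈ strip R 1, (φ w).2 ≠ 0 := fun w hw =>
    (eps_bound (hn w hw) (hφ w hw).2.2.2.2.2.1).1
  have hGD : Set.MapsTo G (strip (R + 1) (1 / 2)) (strip (R + 1) (1 / 2)) := by
    intro w hw
    obtain ⟨h1, h2, -⟩ := hφ w (hsub hw)
    exact ⟨by linarith [hw.1], h2 _ le_rfl hw.2⟩
  have hit : ∀ n : ℕ, ∀ w ∈ strip (R + 1) (1 / 2),
      G^[n] w ∈ strip (R + 1) (1 / 2) ∧ P^[n] (φ w) = φ (G^[n] w) := by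
    intro n w hw
    induction n with
    | zero => exact ⟨hw, rfl⟩
    | succ n ih =>
      rw [Function.iterate_succ_apply', Function.iterate_succ_apply', ih.2,
        hstep _ (hsub ih.1)]
      exact ⟨hGD ih.1, rfl⟩
  have hpt : ∀ t : ℝ, R + 1 < t → ((t : ℂ) ∈ strip (R + 1) (1 / 2)) := by
    intro t ht
    refine ⟨by simpa using ht, by simp⟩
  have hnon : (strip (R + 1) (1 / 2)).Nonempty := ⟨_, hpt (R + 2) (by linarith)⟩
  refine ⟨φ '' strip (R + 1) (1 / 2), ⟨⟨strip (R + 1) (1 / 2), φ, strip_open _ _,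
    (strip_convex _ _).isConnected hnon, ?_, hφd.mono hsub, ?_, rfl⟩, ?_, ?_, ?_, ?_⟩, ?_⟩
  · haveI := (strip_convex (R + 1) (1 / 2)).contractibleSpace hnon
    infer_instance
  · have := strip_inj hR (f := fun w => (φ w).2) hφd.snd
      (fun w hw => (hφ w hw).2.2.2.2.2.1)
    intro w₁ h₁ w₂ h₂ h
    exact this h₁ h₂ (congrArg Prod.snd h)
  · rw [Metric.mem_closure_iff]
    intro ε hε
    set t : ℝ := R + 2 + 4 / ε with ht
    have h4 : 0 < 4 / ε := by positivity
    have hm := hpt t (by linarith)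
    refine ⟨φ t, ⟨_, hm, rfl⟩, ?_⟩
    rw [dist_zero_left]
    refine lt_of_le_of_lt (hφ _ (hsub hm)).2.2.2.1 ?_
    have htn : ‖(t : ℂ)‖ = t := by
      rw [Complex.norm_real, Real.norm_of_nonneg (by linarith)]
    rw [htn, ← div_eq_mul_inv, div_lt_iff₀ (by linarith)]
    have : ε * t = ε * (R + 2) + 4 := by rw [ht]; field_simp
    nlinarith
  · rintro ⟨w, hw, h⟩
    exact hne w (hsub hw) (by rw [h]; rfl)
  · rintro _ ⟨_, ⟨w, hw, rfl⟩, rfl⟩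
    rw [hstep w (hsub hw)]
    exact ⟨_, hGD hw, rfl⟩
  · intro K hK _
    rw [Metric.tendstoUniformlyOn_iff]
    intro ε hε
    obtain ⟨N, hN⟩ := exists_nat_gt (2 * (4 / ε) ^ 2)
    filter_upwards [eventually_ge_atTop N] with n hnN z hz
    obtain ⟨w, hw, rfl⟩ := hK hz
    obtain ⟨h1, h2⟩ := hit n w hw
    have hg := growth_iter hGD (fun w hw => (hφ w (hsub hw)).2.2.1) n w hw
    rw [h2, Pi.zero_apply, dist_zero_left]
    refine lt_of_le_of_lt (hφ _ (hsub h1)).2.2.2.1 ?_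
    have hnN' : (N : ℝ) ≤ n := by exact_mod_cast hnN
    have h3 : 4 / ε < ‖G^[n] w‖ := by
      apply lt_of_pow_lt_pow_left₀ 2 (norm_nonneg _)
      linarith
    have h2' := hn _ (hsub h1)
    rw [← div_eq_mul_inv, div_lt_iff₀ (by linarith)]
    rw [div_lt_iff₀ hε] at h3
    linarith
  · intro h
    obtain ⟨w, hw⟩ := hnon
    exact hne w (hsub hw) (h ⟨w, hw, rfl⟩)
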